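/- Let U be a convex open subset of M(Σ_D) and let μ, μ' ∈ U ∩ M^e_α(Σ_D) be distinct CO-measures satisfying ∫ E_α∘φ_α dμ > 1 and ∫ E_α∘φ_α dμ' > 1. Then there exists a high complexity path that lies in U ∩ M^e_α(Σ_D) and joins μ and μ'. -/

import Mathlib

open MeasureTheory Topology Filter
open scoped ENNReal NNReal


/-! ### The alphabet of the (M,N) Dyck–Motzkin shift -/

/-- The alphabet `D = D_α ∪ D_0 ∪ D_β` of the `(M,N)` Dyck–Motzkin shift:
`la k` is the left bracket `α_k`, `u k` is the unit `1_k`, `ra k` is the right bracket `β_k`. -/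
inductive DMSym (M N : ℕ) : Type where
  | la : Fin M → DMSym M N
  | u  : Fin N → DMSym M N
  | ra : Fin M → DMSym M N
deriving DecidableEq

namespace DMSym

def equivSum (M N : ℕ) : DMSym M N ≃ (Fin M ⊕ Fin N ⊕ Fin M) where
  toFun s := match s with
    | .la k => Sum.inl k
    | .u k => Sum.inr (Sum.inl k)
    | .ra k => Sum.inr (Sum.inr k)
  invFun s := match s with
    | Sum.inl k => .la k
    | Sum.inr (Sum.inl k) => .u k
    | Sum.inr (Sum.inr k) => .ra k
  left_inv s := by cases s <;> rfl
  right_inv s := by rcases s with k | k | k <;> rfl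

instance (M N : ℕ) : Fintype (DMSym M N) := Fintype.ofEquiv _ (equivSum M N).symm
instance (M N : ℕ) : TopologicalSpace (DMSym M N) := ⊥
instance (M N : ℕ) : DiscreteTopology (DMSym M N) := ⟨rfl⟩
instance (M N : ℕ) : MeasurableSpace (DMSym M N) := ⊤
instance (M N : ℕ) : BorelSpace (DMSym M N) := ⟨borel_eq_top_of_discrete.symm⟩

end DMSym

/-- Nonzero elements of the Dyck–Motzkin monoid with zero are represented in normal form:
`some (bs, as)` is the reduced word `β_{bs(0)} ⋯ β_{bs(r)} α_{as(0)} ⋯ α_{as(s)}`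
(in particular `some ([], [])` is the unit element `1`); `none` is the zero element `0`. -/
abbrev DyckElem (M : ℕ) := Option (List (Fin M) × List (Fin M))

/-- Multiplication, in the Dyck–Motzkin monoid with zero, of an element in normal form on
the right by a generator: units are absorbed, a left bracket is appended, and a right bracket
either closes the last left bracket (if the indices match), is appended (if there is no left
bracket to close), or produces the zero element (if the indices do not match). -/
def dyckStep {M N : ℕ} : DyckElem M → DMSym M N → DyckElem M
  | none, _ => none
  | some (bs, as), .la k => some (bs, as ++ [k])
  | some (bs, as), .u _ => some (bs, as)
  | some (bs, as), .ra k =>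
      match as.getLast? with
      | none => some (bs ++ [k], [])
      | some j => if j = k then some (bs, as.dropLast) else none

/-- `red w` is the image of the word `w` in the Dyck–Motzkin monoid with zero. -/
def red {M N : ℕ} (w : List (DMSym M N)) : DyckElem M :=
  w.foldl dyckStep (some ([], []))

/-- The word `x_j x_{j+1} ⋯ x_k` read off a bi-infinite sequence `x`. -/
def wordAt {M N : ℕ} (x : ℤ → DMSym M N) (j k : ℤ) : List (DMSym M N) :=
  (List.range (k + 1 - j).toNat).map fun n => x (j + n)

/-- The `(M,N)` Dyck–Motzkin shift `Σ_D`. -/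
def SigmaD (M N : ℕ) : Set (ℤ → DMSym M N) :=
  {x | ∀ j k : ℤ, j < k → red (wordAt x j k) ≠ none}

/-- The left shift `σ`. -/
def shift {A : Type*} : (ℤ → A) → (ℤ → A) := fun x i => x (i + 1)

/-- The inverse `σ⁻¹` of the left shift. -/
def shiftInv {A : Type*} : (ℤ → A) → (ℤ → A) := fun x i => x (i - 1)

lemma wordAt_shift {M N : ℕ} (x : ℤ → DMSym M N) (j k : ℤ) :
    wordAt (shift x) j k = wordAt x (j + 1) (k + 1) := by
  simp only [wordAt, shift]
  rw [show (k + 1 + 1 - (j + 1) : ℤ) = k + 1 - j by ring]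
  exact List.map_congr_left fun n _ => by rw [show (j + n + 1 : ℤ) = j + 1 + n by ring]

lemma shift_mem_SigmaD {M N : ℕ} {x : ℤ → DMSym M N} (hx : x ∈ SigmaD M N) :
    shift x ∈ SigmaD M N := by
  intro j k hjk
  rw [wordAt_shift]
  exact hx (j + 1) (k + 1) (by omega)

/-- The left shift acting on `Σ_D`. -/
def shiftD (M N : ℕ) : ↥(SigmaD M N) → ↥(SigmaD M N) :=
  fun x => ⟨shift x.val, shift_mem_SigmaD x.property⟩

section Generic
variable {X : Type*} [MeasurableSpace X]

/-- The set of `T`-invariant Borel probability measures. -/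
def InvMeas (T : X → X) : Set (ProbabilityMeasure X) :=
  {μ | MeasurePreserving T μ.toMeasure μ.toMeasure}

/-- The set of `T`-invariant ergodic Borel probability measures. -/
def ErgMeas (T : X → X) : Set (ProbabilityMeasure X) :=
  {μ | Ergodic T μ.toMeasure}

/-- A `CO`-measure: an invariant ergodic probability measure supported on the orbit of a
single periodic point. -/
def IsCOMeas (T : X → X) (μ : ProbabilityMeasure X) : Prop :=
  Ergodic T μ.toMeasure ∧
    ∃ (x : X) (n : ℕ), 0 < n ∧ T^[n] x = x ∧
      μ.toMeasure {y | ∃ k : ℕ, y = T^[k] x} = 1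

/-- Convexity for a set of probability measures: it is stable under taking the convex
combination `t•μ + (1-t)•ν` of any two of its members. -/
def ConvexMeasSet (U : Set (ProbabilityMeasure X)) : Prop :=
  ∀ μ ∈ U, ∀ ν ∈ U, ∀ t : ℝ≥0∞, t ≤ 1 → ∀ ρ : ProbabilityMeasure X,
    ρ.toMeasure = t • μ.toMeasure + (1 - t) • ν.toMeasure → ρ ∈ U

/-- A measure is fully supported if it gives positive measure to every non-empty open set. -/
def FullSupp [TopologicalSpace X] (μ : ProbabilityMeasure X) : Prop :=
  ∀ U : Set X, IsOpen U → U.Nonempty → 0 < μ.toMeasure U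

/-- Measure-theoretic isomorphism of the measure-preserving systems `(X,T,μ)` and `(Y,S,ν)`. -/
def MeasureIso {Y : Type*} [MeasurableSpace Y] (T : X → X) (S : Y → Y)
    (μ : Measure X) (ν : Measure Y) : Prop :=
  ∃ (φ : X → Y) (ψ : Y → X), Measurable φ ∧ Measurable ψ ∧
    Measure.map φ μ = ν ∧ Measure.map ψ ν = μ ∧
    (∀ᵐ x ∂μ, ψ (φ x) = x) ∧ (∀ᵐ y ∂ν, φ (ψ y) = y) ∧
    (∀ᵐ x ∂μ, φ (T x) = S (φ x))

/-- The system `(X,T,μ)` is Bernoulli: it is measure-theoretically isomorphic to a two-sided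
Bernoulli shift, i.e. the left shift on `ℤ → ℕ` equipped with an i.i.d. product measure
(determined by requiring that the measures of all cylinder sets factorize according to a
fixed distribution `p`). -/
def IsBernoulli (T : X → X) (μ : Measure X) : Prop :=
  ∃ (p : ℕ → ℝ≥0∞) (ν : Measure (ℤ → ℕ)), (∑' n, p n) = 1 ∧
    IsProbabilityMeasure ν ∧
    (∀ (n : ℕ) (w : Fin n → ℕ) (j : ℤ),
      ν {y | ∀ i : Fin n, y (j + (i : ℕ)) = w i} = ∏ i, p (w i)) ∧
    MeasureIso T shift μ ν

end Generic

/-- `M(Σ_D)`: the space of shift-invariant Borel probability measures on `Σ_D`,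
endowed with the weak* topology. -/
def MinvD (M N : ℕ) : Set (ProbabilityMeasure ↥(SigmaD M N)) := InvMeas (shiftD M N)

/-- `M^e(Σ_D)`: the shift-invariant ergodic Borel probability measures on `Σ_D`. -/
def MergD (M N : ℕ) : Set (ProbabilityMeasure ↥(SigmaD M N)) := ErgMeas (shiftD M N)

/-- The integral `∫ f dμ`. -/
noncomputable def intCf {M N : ℕ} (f : C(↥(SigmaD M N), ℝ))
    (μ : ProbabilityMeasure ↥(SigmaD M N)) : ℝ := ∫ x, f x ∂μ.toMeasure

/-- `M_max(f)`: the set of `f`-maximizing measures, i.e. the shift-invariant measures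
attaining `sup { ∫ f dν : ν ∈ M(Σ_D) }`. -/
def Mmax (M N : ℕ) (f : C(↥(SigmaD M N), ℝ)) : Set (ProbabilityMeasure ↥(SigmaD M N)) :=
  {μ ∈ MinvD M N | ∀ ν ∈ MinvD M N, intCf f ν ≤ intCf f μ}

/-- `G_j(x)`: `1` on left brackets, `-1` on right brackets, `0` on units. -/
def Gfun {M N : ℕ} (x : ℤ → DMSym M N) (j : ℤ) : ℤ :=
  match x j with
  | .la _ => 1
  | .u _ => 0
  | .ra _ => -1

/-- `H_i(x) = Σ_{j=0}^{i-1} G_j(x)` for `i ≥ 1`, `H_i(x) = -Σ_{j=i}^{-1} G_j(x)` for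
`i ≤ -1`, and `H_0(x) = 0`. -/
def Hfun {M N : ℕ} (x : ℤ → DMSym M N) (i : ℤ) : ℤ :=
  if 0 ≤ i then ∑ j ∈ Finset.range i.toNat, Gfun x (j : ℤ)
  else -∑ j ∈ Finset.range (-i).toNat, Gfun x (i + (j : ℤ))

/-- The set `A_0`. -/
def A0set (M N : ℕ) : Set (ℤ → DMSym M N) :=
  SigmaD M N ∩ {x | ∀ i : ℤ,
    (∃ j : ℕ, 1 ≤ j ∧ Hfun x (i + (j : ℤ)) = Hfun x i) ∧
    (∃ j : ℕ, 1 ≤ j ∧ Hfun x (i - (j : ℤ)) = Hfun x i)}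

/-- The set `A_α`. -/
def AalphaSet (M N : ℕ) : Set (ℤ → DMSym M N) :=
  SigmaD M N ∩ {x | Tendsto (Hfun x) atTop atTop ∧ Tendsto (Hfun x) atBot atBot}

/-- The set `A_β`. -/
def AbetaSet (M N : ℕ) : Set (ℤ → DMSym M N) :=
  SigmaD M N ∩ {x | Tendsto (Hfun x) atTop atBot ∧ Tendsto (Hfun x) atBot atTop}

/-- The set `B_α` of sequences in `Σ_D` in which every right bracket is closed. -/
def BalphaSet (M N : ℕ) : Set (ℤ → DMSym M N) :=
  SigmaD M N ∩ {x | ∀ i : ℤ, (∃ k, x i = DMSym.ra k) →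
    ∃ j : ℕ, 1 ≤ j ∧ Hfun x (i - (j : ℤ) + 1) = Hfun x (i + 1)}

/-- The set `B_β` of sequences in `Σ_D` in which every left bracket is closed. -/
def BbetaSet (M N : ℕ) : Set (ℤ → DMSym M N) :=
  SigmaD M N ∩ {x | ∀ i : ℤ, (∃ k, x i = DMSym.la k) →
    ∃ j : ℕ, 1 ≤ j ∧ Hfun x (i + (j : ℤ)) = Hfun x i}

/-- The alphabet `D_α ∪ D_0 ∪ {β}` of the full shift `Σ_α`. -/
inductive AlSym (M N : ℕ) : Type where
  | la : Fin M → AlSym M N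
  | u  : Fin N → AlSym M N
  | b  : AlSym M N
deriving DecidableEq

namespace AlSym

def equivSum (M N : ℕ) : AlSym M N ≃ (Fin M ⊕ Fin N ⊕ Unit) where
  toFun s := match s with
    | .la k => Sum.inl k
    | .u k => Sum.inr (Sum.inl k)
    | .b => Sum.inr (Sum.inr ())
  invFun s := match s with
    | Sum.inl k => .la k
    | Sum.inr (Sum.inl k) => .u k
    | Sum.inr (Sum.inr _) => .b
  left_inv s := by cases s <;> rfl
  right_inv s := by rcases s with k | k | k <;> rfl

instance (M N : ℕ) : Fintype (AlSym M N) := Fintype.ofEquiv _ (equivSum M N).symm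
instance (M N : ℕ) : TopologicalSpace (AlSym M N) := ⊥
instance (M N : ℕ) : DiscreteTopology (AlSym M N) := ⟨rfl⟩
instance (M N : ℕ) : MeasurableSpace (AlSym M N) := ⊤
instance (M N : ℕ) : BorelSpace (AlSym M N) := ⟨borel_eq_top_of_discrete.symm⟩

end AlSym

/-- The factor map `φ_α : Σ_D → Σ_α` replacing every right bracket by the single symbol `β`. -/
def phiAl {M N : ℕ} (x : ℤ → DMSym M N) : ℤ → AlSym M N := fun i =>
  match x i with
  | .la k => .la k
  | .u k => .u k
  | .ra _ => .b

/-- `K_α = φ_α(B_α)`. -/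
def Kalpha (M N : ℕ) : Set (ℤ → AlSym M N) := phiAl '' BalphaSet M N

/-- `G_{α,j}`. -/
def GAl {M N : ℕ} (y : ℤ → AlSym M N) (j : ℤ) : ℤ :=
  match y j with
  | .la _ => 1
  | .u _ => 0
  | .b => -1

/-- `H_{α,i}`. -/
def HAl {M N : ℕ} (y : ℤ → AlSym M N) (i : ℤ) : ℤ :=
  if 0 ≤ i then ∑ j ∈ Finset.range i.toNat, GAl y (j : ℤ)
  else -∑ j ∈ Finset.range (-i).toNat, GAl y (i + (j : ℤ))

/-- `s_α(i,y) = max { j < i+1 : H_{α,j}(y) = H_{α,i+1}(y) }`. -/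
noncomputable def sAl {M N : ℕ} (y : ℤ → AlSym M N) (i : ℤ) : ℤ :=
  sSup {j : ℤ | j < i + 1 ∧ HAl y j = HAl y (i + 1)}

/-- `ψ_α : K_α → Σ_D`, replacing each `β` by the right bracket matching the left bracket at
position `s_α(i,y)` (defined as a total function using a junk value outside `K_α`). -/
noncomputable def psiAl (M N : ℕ) (hM : 0 < M) (y : ℤ → AlSym M N) : ℤ → DMSym M N := fun i =>
  match y i with
  | .la k => .la k
  | .u k => .u k
  | .b =>
    match y (sAl y i) with
    | .la k => .ra k
    | _ => .ra ⟨0, hM⟩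

/-- The function `E_α = 2·𝟙_{Σ_α(α)} + 𝟙_{Σ_α(0)}`. -/
def EAl {M N : ℕ} (y : ℤ → AlSym M N) : ℝ :=
  match y 0 with
  | .la _ => 2
  | .u _ => 1
  | .b => 0

/-- `M^{CO}(Σ_D)`: the set of `CO`-measures on `Σ_D`. -/
def MCO (M N : ℕ) : Set (ProbabilityMeasure ↥(SigmaD M N)) :=
  {μ | IsCOMeas (shiftD M N) μ}

/-- `M^e_0(Σ_D) = { μ ∈ M^e(Σ_D) : μ(A_0) = 1 }`. -/
def Me0 (M N : ℕ) : Set (ProbabilityMeasure ↥(SigmaD M N)) :=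
  {μ ∈ MergD M N | μ.toMeasure (Subtype.val ⁻¹' A0set M N) = 1}

/-- `M^e_α(Σ_D) = { μ ∈ M^e(Σ_D) : μ(A_α) = 1 }`. -/
def MeAl (M N : ℕ) : Set (ProbabilityMeasure ↥(SigmaD M N)) :=
  {μ ∈ MergD M N | μ.toMeasure (Subtype.val ⁻¹' AalphaSet M N) = 1}

/-- `M^e_β(Σ_D) = { μ ∈ M^e(Σ_D) : μ(A_β) = 1 }`. -/
def MeBe (M N : ℕ) : Set (ProbabilityMeasure ↥(SigmaD M N)) :=
  {μ ∈ MergD M N | μ.toMeasure (Subtype.val ⁻¹' AbetaSet M N) = 1}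

/-- A high complexity path: a path of ergodic measures such that (A1) all but countably
many of its points are fully supported and Bernoulli, and (A2) every value is attained
only countably often. -/
def HCPath (M N : ℕ) (p : unitInterval → ProbabilityMeasure ↥(SigmaD M N)) : Prop :=
  Continuous p ∧ (∀ t, p t ∈ MergD M N) ∧
  Set.Countable {t : unitInterval |
    ¬(FullSupp (p t) ∧ IsBernoulli (shiftD M N) (p t).toMeasure)} ∧
  ∀ t : unitInterval, Set.Countable {s : unitInterval | p s = p t}

namespace HCP

/-! ### Part A: words, stacks and the lift from the full shift to the Dyck–Motzkin shift -/

/-- The letterwise factor map. -/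
def phS {M N : ℕ} : DMSym M N → AlSym M N
  | .la k => .la k
  | .u k => .u k
  | .ra _ => .b

lemma phiAl_apply {M N : ℕ} (x : ℤ → DMSym M N) (i : ℤ) : phiAl x i = phS (x i) := by
  unfold phiAl phS; cases x i <;> rfl

/-- Height increment of a letter. -/
def gS {M N : ℕ} : AlSym M N → ℤ
  | .la _ => 1
  | .u _ => 0
  | .b => -1

lemma gS_ge {M N : ℕ} (a : AlSym M N) : -1 ≤ gS a := by cases a <;> simp [gS]
lemma gS_le {M N : ℕ} (a : AlSym M N) : gS a ≤ 1 := by cases a <;> simp [gS]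

lemma Gfun_eq {M N : ℕ} (x : ℤ → DMSym M N) (i : ℤ) : Gfun x i = gS (phS (x i)) := by
  unfold Gfun phS gS; cases x i <;> rfl

lemma EAl_eq {M N : ℕ} (x : ℤ → DMSym M N) : EAl (phiAl x) = 1 + (gS (phS (x 0)) : ℝ) := by
  unfold EAl; rw [phiAl_apply]; cases x 0 <;> simp [phS, gS]; norm_num

lemma Hfun_zero {M N : ℕ} (x : ℤ → DMSym M N) : Hfun x 0 = 0 := by simp [Hfun]

lemma Hfun_succ {M N : ℕ} (x : ℤ → DMSym M N) (i : ℤ) :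
    Hfun x (i + 1) = Hfun x i + gS (phS (x i)) := by
  rw [← Gfun_eq]
  unfold Hfun
  by_cases h : 0 ≤ i
  · rw [if_pos h, if_pos (by omega), show (i + 1).toNat = i.toNat + 1 by omega,
      Finset.sum_range_succ]
    congr 2; omega
  · rw [if_neg h]
    obtain ⟨n, rfl⟩ : ∃ n : ℕ, i = -((n : ℤ) + 1) := ⟨(-i - 1).toNat, by omega⟩
    have e1 : (-(-((n : ℤ) + 1))).toNat = n + 1 := by omega
    rw [e1, Finset.sum_range_succ']
    rcases Nat.eq_zero_or_pos n with rfl | hn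
    · simp
    · rw [if_neg (by omega)]
      have e2 : (-(-((n : ℤ) + 1) + 1)).toNat = n := by omega
      rw [e2]
      have : ∀ j ∈ Finset.range n, Gfun x (-((n : ℤ) + 1) + 1 + (j : ℤ))
          = Gfun x (-((n : ℤ) + 1) + ((j + 1 : ℕ) : ℤ)) := by
        intro j _; congr 1; push_cast; ring
      rw [Finset.sum_congr rfl this]
      simp

/-- One step of the stack (head is the top). -/
def stk {M N : ℕ} : List (Fin M) → AlSym M N → List (Fin M)
  | s, .la k => k :: s
  | s, .u _ => s
  | s, .b => s.tail

/-- Lift of a letter given the stack. -/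
def lsym {M N : ℕ} (k0 : Fin M) (s : List (Fin M)) : AlSym M N → DMSym M N
  | .la k => .la k
  | .u k => .u k
  | .b => .ra (s.headD k0)

lemma phS_lsym {M N : ℕ} (k0 : Fin M) (s : List (Fin M)) (a : AlSym M N) :
    phS (lsym k0 s a) = a := by cases a <;> rfl

/-- The stack after reading `y_j, …, y_{j+n-1}` starting with stack `s`. -/
def stkRun {M N : ℕ} (y : ℤ → AlSym M N) (j : ℤ) (s : List (Fin M)) : ℕ → List (Fin M)
  | 0 => s
  | n + 1 => stk (stkRun y j s n) (y (j + n))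

lemma stkRun_add {M N : ℕ} (y : ℤ → AlSym M N) (j : ℤ) (s : List (Fin M)) (n m : ℕ) :
    stkRun y j s (n + m) = stkRun y (j + n) (stkRun y j s n) m := by
  induction m with
  | zero => rfl
  | succ m ih =>
    rw [← add_assoc]; simp only [stkRun, ih]; congr 2; push_cast; ring

lemma stkRun_append {M N : ℕ} (y : ℤ → AlSym M N) (j : ℤ) (s : List (Fin M)) (n : ℕ) :
    ∃ r, stkRun y j s n = stkRun y j [] n ++ r := by
  induction n with
  | zero => exact ⟨s, by simp [stkRun]⟩
  | succ n ih =>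
    obtain ⟨r, hr⟩ := ih
    simp only [stkRun, hr]
    cases y (j + n) with
    | la k => exact ⟨r, by simp [stk]⟩
    | u k => exact ⟨r, by simp [stk]⟩
    | b =>
      cases h : stkRun y j [] n with
      | nil => exact ⟨r.tail, by simp [stk]⟩
      | cons a l => exact ⟨r, by simp [stk]⟩

lemma stkRun_congr {M N : ℕ} (y y' : ℤ → AlSym M N) (j : ℤ) (s : List (Fin M)) (n : ℕ)
    (h : ∀ r : ℕ, r < n → y (j + r) = y' (j + r)) : stkRun y j s n = stkRun y' j s n := by
  induction n with
  | zero => rfl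
  | succ n ih =>
    simp only [stkRun]
    rw [ih fun r hr => h r (by omega), h n (by omega)]

/-- The stack before reading position `i`, having started `n` steps earlier. -/
def stkAt {M N : ℕ} (y : ℤ → AlSym M N) (i : ℤ) (n : ℕ) : List (Fin M) :=
  stkRun y (i - n) [] n

lemma stkAt_append {M N : ℕ} (y : ℤ → AlSym M N) (i : ℤ) (n m : ℕ) (h : n ≤ m) :
    ∃ r, stkAt y i m = stkAt y i n ++ r := by
  obtain ⟨d, rfl⟩ := Nat.exists_eq_add_of_le' h
  unfold stkAt
  rw [stkRun_add]
  have : i - ((d + n : ℕ) : ℤ) + d = i - n := by push_cast; ring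
  rw [this]
  exact stkRun_append _ _ _ _

open Classical in
/-- The depth to look back at to see the top of the stack. -/
noncomputable def depth {M N : ℕ} (y : ℤ → AlSym M N) (i : ℤ) : ℕ :=
  sInf {n | stkAt y i n ≠ []}

/-- The lift of `y` to the Dyck–Motzkin alphabet. -/
noncomputable def lift {M N : ℕ} (k0 : Fin M) (y : ℤ → AlSym M N) : ℤ → DMSym M N := fun i =>
  lsym k0 (stkAt y i (depth y i)) (y i)

lemma phS_lift {M N : ℕ} (k0 : Fin M) (y : ℤ → AlSym M N) (i : ℤ) : phS (lift k0 y i) = y i :=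
  phS_lsym _ _ _

lemma lift_eq {M N : ℕ} (k0 : Fin M) (y : ℤ → AlSym M N) (i : ℤ) (n : ℕ)
    (h : stkAt y i n ≠ []) : lift k0 y i = lsym k0 (stkAt y i n) (y i) := by
  have h1 : depth y i ≤ n := Nat.sInf_le h
  have h2 : stkAt y i (depth y i) ≠ [] := Nat.sInf_mem (s := {n | stkAt y i n ≠ []}) ⟨n, h⟩
  obtain ⟨r, hr⟩ := stkAt_append y i _ _ h1
  unfold lift
  cases h3 : stkAt y i (depth y i) with
  | nil => exact absurd h3 h2
  | cons a l => rw [hr, h3]; cases y i <;> simp [lsym]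

lemma stkAt_shift {M N : ℕ} (y : ℤ → AlSym M N) (i : ℤ) (n : ℕ) :
    stkAt (shift y) i n = stkAt y (i + 1) n := by
  have : ∀ (j : ℤ) (n : ℕ), stkRun (shift y) j [] n = stkRun y (j + 1) [] n := by
    intro j n
    induction n with
    | zero => rfl
    | succ n ih => simp only [stkRun, ih, shift]; congr 2; ring
  unfold stkAt
  rw [this]; congr 1; ring

lemma lift_shift {M N : ℕ} (k0 : Fin M) (y : ℤ → AlSym M N) :
    lift k0 (shift y) = shift (lift k0 y) := by
  funext i
  simp only [lift, depth, stkAt_shift, shift]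

lemma dyckStep_mono {M N : ℕ} (w : List (DMSym M N)) :
    ∀ (bs bs' c as : List (Fin M)), w.foldl dyckStep (some (bs, c ++ as)) ≠ none →
      w.foldl dyckStep (some (bs', as)) ≠ none := by
  induction w with
  | nil => intro bs bs' c as _; simp
  | cons a w ih =>
    intro bs bs' c as h
    have hn : ∀ v : List (DMSym M N), v.foldl dyckStep none = none := by
      intro v; induction v with
      | nil => rfl
      | cons a v ih => simpa [dyckStep] using ih
    simp only [List.foldl_cons] at h ⊢
    cases a with
    | la k =>
      simp only [dyckStep] at h ⊢
      rw [List.append_assoc] at h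
      exact ih _ _ _ _ h
    | u k => exact ih _ _ _ _ h
    | ra k =>
      rcases List.eq_nil_or_concat as with rfl | ⟨l, q, rfl⟩
      · simp only [dyckStep, List.append_nil, List.getLast?_nil] at h ⊢
        rcases List.eq_nil_or_concat c with rfl | ⟨l, q, rfl⟩
        · exact ih (bs ++ [k]) _ [] [] (by simpa using h)
        · simp only [List.concat_eq_append, List.getLast?_append, List.getLast?_singleton,
            Option.some_or, List.dropLast_concat] at h
          split_ifs at h
          · exact ih _ _ l [] (by simpa using h)
          · exact absurd (hn _) h
      · simp only [dyckStep, List.concat_eq_append, ← List.append_assoc, List.getLast?_append,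
          List.getLast?_singleton, Option.some_or, List.dropLast_concat] at h ⊢
        split_ifs at h ⊢
        · exact ih _ _ c l h
        · exact absurd (hn _) h

/-- Words as lists read from a function. -/
def wd {M N : ℕ} (x : ℤ → DMSym M N) (j : ℤ) (l : ℕ) : List (DMSym M N) :=
  (List.range l).map fun n : ℕ => x (j + n)

lemma wd_succ {M N : ℕ} (x : ℤ → DMSym M N) (j : ℤ) (l : ℕ) :
    wd x j (l + 1) = wd x j l ++ [x (j + l)] := by simp [wd, List.range_succ]

lemma wordAt_eq {M N : ℕ} (x : ℤ → DMSym M N) (j k : ℤ) :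
    wordAt x j k = wd x j (k + 1 - j).toNat := by
  simp only [wordAt, wd]
  generalize (k + 1 - j).toNat = l
  have : (List.range l >>= fun a : ℕ => (pure (a : ℤ) : List ℤ)) =
      (List.range l).map fun a : ℕ => (a : ℤ) := by
    simp [List.map_eq_flatMap]
  rw [this, List.map_map]
  rfl

lemma SigmaD_wd {M N : ℕ} {x : ℤ → DMSym M N} (hx : x ∈ SigmaD M N) (j : ℤ) (l : ℕ) :
    red (wd x j (l + 2)) ≠ none := by
  have := hx j (j + l + 1) (by omega)
  rw [wordAt_eq, show (j + l + 1 + 1 - j).toNat = l + 2 by omega] at this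
  exact this

lemma red_concat {M N : ℕ} (w : List (DMSym M N)) (a : DMSym M N) :
    red (w ++ [a]) = dyckStep (red w) a := by simp [red]

lemma foldl_lift {M N : ℕ} (k0 : Fin M) (y : ℤ → AlSym M N) (j : ℤ) (n l : ℕ)
    (h : ∀ r : ℕ, r < l → stkAt y (j + r) (n + r) ≠ []) :
    (wd (lift k0 y) j l).foldl dyckStep (some ([], (stkAt y j n).reverse))
      = some ([], (stkAt y (j + l) (n + l)).reverse) := by
  induction l with
  | zero => simp [wd]
  | succ l ih =>
    rw [wd_succ, List.foldl_append, ih fun r hr => h r (by omega)]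
    have h1 := h l (by omega)
    rw [lift_eq k0 y (j + l) (n + l) h1]
    have h2 : stkAt y (j + (l + 1 : ℕ)) (n + (l + 1)) = stk (stkAt y (j + l) (n + l)) (y (j + l)) := by
      unfold stkAt
      rw [← add_assoc n l 1]
      simp only [stkRun]
      have e1 : j + ((l + 1 : ℕ) : ℤ) - ((n + l + 1 : ℕ) : ℤ) = j + l - ((n + l : ℕ) : ℤ) := by
        push_cast; ring
      rw [e1]
      congr 2; push_cast; ring
    rw [h2]
    cases h3 : stkAt y (j + l) (n + l) with
    | nil => exact absurd h3 h1
    | cons a s => cases y (j + l) <;> simp [lsym, stk, dyckStep]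

lemma lift_mem {M N : ℕ} (k0 : Fin M) (y : ℤ → AlSym M N)
    (h : ∀ i, ∃ n, stkAt y i n ≠ []) : lift k0 y ∈ SigmaD M N := by
  intro j k hjk
  rw [wordAt_eq]
  generalize (k + 1 - j).toNat = l
  choose f hf using h
  obtain ⟨n, hn⟩ : ∃ n : ℕ, ∀ r : ℕ, r < l → stkAt y (j + r) (n + r) ≠ [] := by
    refine ⟨(Finset.range l).sup fun r : ℕ => f (j + r), fun r hr => ?_⟩
    have h1 : f (j + r) ≤ (Finset.range l).sup fun r : ℕ => f (j + r) :=
      Finset.le_sup (f := fun r : ℕ => f (j + r)) (Finset.mem_range.2 hr)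
    obtain ⟨s, hs⟩ := stkAt_append y (j + r) (f (j + r)) _ (h1.trans (Nat.le_add_right _ r))
    rw [hs]
    have := hf (j + r)
    simp [this]
  have := foldl_lift k0 y j n l hn
  refine dyckStep_mono _ [] [] (stkAt y j n).reverse [] ?_
  rw [List.append_nil, this]; simp

lemma red_nil_of_concat {M N : ℕ} (v : List (DMSym M N)) (a : DMSym M N) (s : List (Fin M))
    (h : red (v ++ [a]) = some ([], s)) : ∃ s', red v = some ([], s') := by
  rw [red_concat] at h
  rcases hv : red v with _ | ⟨bs, as⟩
  · rw [hv] at h; simp [dyckStep] at h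
  · rw [hv] at h
    cases a with
    | la k => simp [dyckStep] at h; exact ⟨as, by rw [h.1]⟩
    | u k => simp [dyckStep] at h; exact ⟨as, by rw [h.1]⟩
    | ra k =>
      simp only [dyckStep] at h
      split at h
      · simp at h
      · split_ifs at h
        simp at h; exact ⟨as, by rw [h.1]⟩

/-- Uniqueness of lifts of words without unmatched right brackets. -/
lemma word_unique {M N : ℕ} (v : List (DMSym M N)) : ∀ (v' : List (DMSym M N)) (s : List (Fin M)),
    v.map phS = v'.map phS → red v = some ([], s) → red v' ≠ none → v = v' := by
  induction v using List.reverseRecOn with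
  | nil => intro v' s h _ _; simpa using h.symm
  | append_singleton v a ih =>
    intro v' s h hv hv'
    rcases List.eq_nil_or_concat v' with rfl | ⟨l, q, rfl⟩
    · simp at h
    rw [List.concat_eq_append] at h hv' ⊢
    simp only [List.map_append, List.map_cons, List.map_nil] at h
    obtain ⟨h1, h2⟩ := List.append_inj' h rfl
    obtain ⟨s', hs'⟩ := red_nil_of_concat v a s hv
    have hl : red l ≠ none := by
      intro h0; rw [red_concat, h0] at hv'; exact hv' rfl
    have := ih l s' h1 hs' hl
    subst this
    congr 1
    rw [red_concat, hs'] at hv hv'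
    simp only [List.cons.injEq, and_true] at h2 ⊢
    cases a with
    | la k => cases q <;> simp_all [phS]
    | u k => cases q <;> simp_all [phS]
    | ra k =>
      cases q with
      | la k' => simp [phS] at h2
      | u k' => simp [phS] at h2
      | ra k' =>
        simp only [dyckStep] at hv hv'
        cases hg : s'.getLast? with
        | none => rw [hg] at hv; simp at hv
        | some c =>
          rw [hg] at hv hv'
          simp only at hv hv'
          split_ifs at hv hv' with h4 h5
          · rw [← h4, ← h5]
          · exact (hv' rfl).elim

/-- Every admissible word can be completed on the left to a word without unmatched
right brackets. -/
lemma word_complete {M N : ℕ} (v : List (DMSym M N)) : ∀ (bs as : List (Fin M)),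
    red v = some (bs, as) → ∀ c, v.foldl dyckStep (some ([], c ++ bs.reverse)) = some ([], c ++ as) := by
  induction v using List.reverseRecOn with
  | nil => intro bs as h c; simp [red] at h; simp [h.1, h.2]
  | append_singleton v a ih =>
    intro bs as h c
    rw [red_concat] at h
    rw [List.foldl_append]
    rcases hv : red v with _ | ⟨bs', as'⟩
    · rw [hv] at h; simp [dyckStep] at h
    · rw [hv] at h
      cases a with
      | la k => simp [dyckStep] at h; obtain ⟨rfl, rfl⟩ := h; rw [ih _ _ hv]; simp [dyckStep]
      | u k => simp [dyckStep] at h; obtain ⟨rfl, rfl⟩ := h; rw [ih _ _ hv]; simp [dyckStep]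
      | ra k =>
        rcases List.eq_nil_or_concat as' with rfl | ⟨l, q, rfl⟩
        · simp [dyckStep] at h
          obtain ⟨rfl, rfl⟩ := h
          have := ih _ _ hv (c ++ [k])
          simp only [List.append_nil, List.reverse_append, List.reverse_cons, List.reverse_nil,
            List.nil_append, ← List.append_assoc] at this ⊢
          rw [this]; simp [dyckStep]
        · simp only [dyckStep, List.concat_eq_append, List.getLast?_append,
            List.getLast?_singleton, Option.some_or, List.dropLast_concat] at h
          split_ifs at h with hq
          simp at h
          obtain ⟨rfl, rfl⟩ := h
          rw [ih _ _ hv]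
          simp only [List.foldl_cons, List.foldl_nil, dyckStep, List.concat_eq_append,
            ← List.append_assoc, List.getLast?_append, List.getLast?_singleton, Option.some_or,
            List.dropLast_concat, hq, if_true]

lemma foldl_la {M N : ℕ} (l s : List (Fin M)) :
    (l.map fun k => (DMSym.la k : DMSym M N)).foldl dyckStep (some ([], s)) = some ([], s ++ l) := by
  induction l generalizing s with
  | nil => simp
  | cons a l ih => simp [dyckStep, ih]

lemma exists_initial {M N : ℕ} (v : List (DMSym M N)) (hv : red v ≠ none) :
    ∃ p s, red (p ++ v) = some ([], s) := by
  rcases h : red v with _ | ⟨bs, as⟩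
  · exact absurd h hv
  refine ⟨bs.reverse.map .la, as, ?_⟩
  unfold red
  rw [List.foldl_append, foldl_la]
  simpa using word_complete v bs as h []

/-- Words of a sequence with nonnegative heights have no unmatched right brackets. -/
lemma red_of_height {M N : ℕ} {x : ℤ → DMSym M N} (hx : x ∈ SigmaD M N)
    (h : ∀ k : ℕ, 0 ≤ Hfun x k) (l : ℕ) :
    ∃ s : List (Fin M), red (wd x 0 l) = some ([], s) ∧ (s.length : ℤ) = Hfun x l := by
  induction l with
  | zero => exact ⟨[], by simp [wd, red], by simp [Hfun_zero]⟩
  | succ l ih =>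
    obtain ⟨s, hs, hl⟩ := ih
    have h0 := h (l + 1)
    have hne : red (wd x 0 (l + 1)) ≠ none := by
      have := SigmaD_wd hx 0 l
      intro h0
      rw [wd_succ, red_concat, h0] at this
      exact this rfl
    rw [wd_succ, red_concat, hs, zero_add] at hne ⊢
    push_cast at h0 ⊢
    rw [Hfun_succ] at h0 ⊢
    cases hc : x l with
    | la k => exact ⟨s ++ [k], by simp [dyckStep], by simp [phS, gS, hl]⟩
    | u k => exact ⟨s, by simp [dyckStep], by simp [phS, gS, hl]⟩
    | ra k =>
      rcases List.eq_nil_or_concat s with rfl | ⟨l', q, rfl⟩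
      · simp only [List.length_nil, Nat.cast_zero] at hl
        rw [← hl, hc] at h0; simp [phS, gS] at h0
      · rw [hc] at hne
        simp only [dyckStep, List.concat_eq_append, List.getLast?_append,
            List.getLast?_singleton, Option.some_or, List.dropLast_concat] at hne ⊢
        split_ifs at hne ⊢ with hq
        · refine ⟨l', rfl, ?_⟩
          simp only [List.concat_eq_append, List.length_append, List.length_singleton] at hl
          push_cast at hl
          simp only [phS, gS]; omega
        · exact absurd rfl hne

lemma stk_length {M N : ℕ} (s : List (Fin M)) (a : AlSym M N) :
    (s.length : ℤ) + gS a ≤ (stk s a).length := by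
  cases a <;> simp [stk, gS]; omega

/-- If heights tend to `-∞` at `-∞` then all stacks are eventually nonempty. -/
lemma exists_stkAt {M N : ℕ} (k0 : Fin M) (y : ℤ → AlSym M N)
    (h : Tendsto (Hfun (lift k0 y)) atBot atBot) (i : ℤ) : ∃ n, stkAt y i n ≠ [] := by
  have key : ∀ (j : ℤ) (n : ℕ),
      Hfun (lift k0 y) (j + n) - Hfun (lift k0 y) j ≤ (stkRun y j [] n).length := by
    intro j n
    induction n with
    | zero => simp [stkRun]
    | succ n ih =>
      have := stk_length (stkRun y j [] n) (y (j + n))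
      rw [Nat.cast_add, Nat.cast_one, ← add_assoc, Hfun_succ, phS_lift]
      simp only [stkRun]; omega
  obtain ⟨j, hj⟩ := (((tendsto_atBot.1 h) (Hfun (lift k0 y) i - 1)).and (eventually_le_atBot i)).exists
  refine ⟨(i - j).toNat, fun h0 => ?_⟩
  have := key (i - (i - j).toNat) (i - j).toNat
  unfold stkAt at h0
  rw [h0, sub_add_cancel, show i - ((i - j).toNat : ℤ) = j by omega] at this
  simp at this; omega

end HCP

namespace HCP

/-! ### Part B: the automaton coding an error sequence `e` into a sequence `Y e` -/

section Automaton
variable {M N : ℕ} (k0 : Fin M) (W : Bool → ℕ → AlSym M N)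

/-- Time elapsed since the last error before `i`. -/
noncomputable def age (e : ℤ → AlSym M N) (i : ℤ) : ℕ := sInf {k : ℕ | e (i - 1 - k) ≠ .la k0}

/-- Mode at time `i`: type of the last error before `i`. -/
noncomputable def mode (e : ℤ → AlSym M N) (i : ℤ) : Bool := decide (e (i - 1 - age k0 e i) = .b)

/-- The expected letter at time `i`. -/
noncomputable def ex (e : ℤ → AlSym M N) (i : ℤ) : AlSym M N := W (mode k0 e i) (age k0 e i)

/-- The coded sequence. -/
noncomputable def Y (e : ℤ → AlSym M N) : ℤ → AlSym M N := fun i =>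
  Equiv.swap (.la k0) (ex k0 W e i) (e i)

/-- Errors occur infinitely often to the left. -/
def Err (e : ℤ → AlSym M N) : Prop := ∀ i : ℤ, ∃ k : ℕ, e (i - 1 - k) ≠ .la k0

variable {k0} {e : ℤ → AlSym M N}

lemma age_spec (he : Err k0 e) (i : ℤ) : e (i - 1 - age k0 e i) ≠ .la k0 :=
  Nat.sInf_mem (s := {k : ℕ | e (i - 1 - k) ≠ .la k0}) (he i)

lemma age_min (i : ℤ) (k : ℕ) (h : k < age k0 e i) : e (i - 1 - k) = .la k0 := by
  by_contra h0
  exact Nat.notMem_of_lt_sInf h h0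

lemma age_eq (i : ℤ) (k : ℕ) (h : e (i - 1 - k) ≠ .la k0)
    (h' : ∀ r : ℕ, r < k → e (i - 1 - r) = .la k0) : age k0 e i = k := by
  apply le_antisymm (Nat.sInf_le h)
  by_contra hlt
  push Not at hlt
  have := Nat.sInf_mem (s := {k : ℕ | e (i - 1 - k) ≠ .la k0}) ⟨k, h⟩
  exact this (h' _ hlt)

lemma age_succ_err (i : ℤ) (h : e i ≠ .la k0) : age k0 e (i + 1) = 0 :=
  age_eq _ 0 (by simpa using h) (by simp)

lemma mode_succ_err (i : ℤ) (h : e i ≠ .la k0) : mode k0 e (i + 1) = decide (e i = .b) := by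
  unfold mode; rw [age_succ_err i h]; simp

lemma age_succ_z (he : Err k0 e) (i : ℤ) (h : e i = .la k0) :
    age k0 e (i + 1) = age k0 e i + 1 := by
  apply age_eq
  · have := age_spec he i
    rwa [show i + 1 - 1 - ((age k0 e i + 1 : ℕ) : ℤ) = i - 1 - age k0 e i by push_cast; ring]
  · intro r hr
    rcases Nat.eq_zero_or_pos r with rfl | hr0
    · simpa using h
    · have := age_min (k0 := k0) (e := e) i (r - 1) (by omega)
      rwa [show i + 1 - 1 - (r : ℤ) = i - 1 - ((r - 1 : ℕ) : ℤ) by omega]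

lemma mode_succ_z (he : Err k0 e) (i : ℤ) (h : e i = .la k0) :
    mode k0 e (i + 1) = mode k0 e i := by
  unfold mode
  rw [age_succ_z he i h,
    show i + 1 - 1 - ((age k0 e i + 1 : ℕ) : ℤ) = i - 1 - age k0 e i by push_cast; ring]

lemma run_z (he : Err k0 e) (i : ℤ) (l : ℕ) (h : ∀ r : ℕ, r < l → e (i + r) = .la k0) :
    age k0 e (i + l) = age k0 e i + l ∧ mode k0 e (i + l) = mode k0 e i := by
  induction l with
  | zero => simp
  | succ l ih =>
    obtain ⟨h1, h2⟩ := ih fun r hr => h r (by omega)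
    have h3 := h l (by omega)
    rw [Nat.cast_add, Nat.cast_one, ← add_assoc, age_succ_z he _ h3, mode_succ_z he _ h3, h1, h2]
    exact ⟨by ring, rfl⟩

lemma age_shift (i : ℤ) : age k0 (shift e) i = age k0 e (i + 1) := by
  unfold age shift
  congr 1; ext k
  rw [Set.mem_setOf_eq, Set.mem_setOf_eq, show i - 1 - (k : ℤ) + 1 = i + 1 - 1 - k by ring]

lemma mode_shift (i : ℤ) : mode k0 (shift e) i = mode k0 e (i + 1) := by
  unfold mode
  rw [age_shift]; unfold shift
  congr 2; rw [show i - 1 - (age k0 e (i + 1) : ℤ) + 1 = i + 1 - 1 - age k0 e (i + 1) by ring]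

lemma Y_shift : Y k0 W (shift e) = shift (Y k0 W e) := by
  funext i
  simp only [Y, ex, age_shift, mode_shift, shift]

lemma Y_z (i : ℤ) (h : e i = .la k0) : Y k0 W e i = ex k0 W e i := by
  simp [Y, h]

/-- Local determination of the coded sequence. -/
lemma Y_congr (he : Err k0 e) (i : ℤ) (e' : ℤ → AlSym M N)
    (h : ∀ r : ℕ, r ≤ age k0 e i + 1 → e' (i - r) = e (i - r)) : Y k0 W e' i = Y k0 W e i := by
  have h1 : ∀ r : ℕ, r ≤ age k0 e i → e' (i - 1 - r) = e (i - 1 - r) := by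
    intro r hr
    have := h (r + 1) (by omega)
    rwa [show i - ((r + 1 : ℕ) : ℤ) = i - 1 - r by push_cast; ring] at this
  have h2 : age k0 e' i = age k0 e i := by
    apply age_eq
    · rw [h1 _ le_rfl]; exact age_spec he i
    · intro r hr; rw [h1 _ hr.le]; exact age_min i r hr
  have h3 : mode k0 e' i = mode k0 e i := by
    unfold mode; rw [h2, h1 _ le_rfl]
  have h4 := h 0 (by omega)
  simp only [Nat.cast_zero, sub_zero] at h4
  simp only [Y, ex, h2, h3, h4]

lemma e_eq_swap (i : ℤ) : e i = Equiv.swap (.la k0) (ex k0 W e i) (Y k0 W e i) := by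
  simp [Y]

/-- Synchronization and injectivity of the coding. -/
lemma Y_inj (n : ℕ) (hW0 : W true 0 ≠ .b)
    (hW : ∀ m k, ∃ r, r < n ∧ W m (k + r) ≠ .b)
    {e e' : ℤ → AlSym M N} (he : Err k0 e) (he' : Err k0 e')
    (hb : ∀ i : ℤ, ∃ j : ℤ, j ≤ i ∧ ∀ r : ℕ, r ≤ n → e (j + r) = .b)
    (hY : Y k0 W e = Y k0 W e') : e = e' := by
  have hbz : (AlSym.b : AlSym M N) ≠ .la k0 := by simp
  funext i
  obtain ⟨j, hj, hjb⟩ := hb (i - n - 1)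
  -- states of e
  have s1 : ∀ r : ℕ, r ≤ n → age k0 e (j + r + 1) = 0 ∧ mode k0 e (j + r + 1) = true := by
    intro r hr
    have h1 := hjb r hr
    have h2 : e (j + r) ≠ .la k0 := by rw [h1]; exact hbz
    rw [age_succ_err _ h2, mode_succ_err _ h2, h1]; simp
  have s2 : ∀ r : ℕ, 1 ≤ r → r ≤ n → Y k0 W e (j + r) = .b := by
    intro r hr hrn
    obtain ⟨h1, h2⟩ := s1 (r - 1) (by omega)
    rw [show j + ((r - 1 : ℕ) : ℤ) + 1 = j + r by omega] at h1 h2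
    unfold Y ex
    rw [h1, h2, hjb r hrn]
    exact Equiv.swap_apply_of_ne_of_ne hbz hW0.symm
  -- a `b` error in e'
  have key : ∀ r : ℕ, 1 ≤ r → r ≤ n → ex k0 W e' (j + r) ≠ .b →
      age k0 e' (j + r + 1) = 0 ∧ mode k0 e' (j + r + 1) = true := by
    intro r hr hrn h
    have h1 : e' (j + r) = .b := by
      rw [e_eq_swap W (e := e') (j + r), ← hY, s2 r hr hrn]
      exact Equiv.swap_apply_of_ne_of_ne hbz h.symm
    have h2 : e' (j + r) ≠ .la k0 := by rw [h1]; exact hbz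
    rw [age_succ_err _ h2, mode_succ_err _ h2, h1]; simp
  have ex1 : ∃ r : ℕ, 1 ≤ r ∧ r ≤ n ∧ ex k0 W e' (j + r) ≠ .b := by
    by_contra hcon
    push Not at hcon
    have hz : ∀ r : ℕ, r < n → e' (j + 1 + r) = .la k0 := by
      intro r hr
      have h3 := hcon (r + 1) (by omega) (by omega)
      have h4 := s2 (r + 1) (by omega) (by omega)
      rw [show j + ((r + 1 : ℕ) : ℤ) = j + 1 + r by push_cast; ring] at h3 h4
      rw [e_eq_swap W (e := e') (j + 1 + r), ← hY, h4, h3]; simp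
    obtain ⟨r, hr, hne⟩ := hW (mode k0 e' (j + 1)) (age k0 e' (j + 1))
    obtain ⟨a1, a2⟩ := run_z he' (j + 1) r fun q hq => hz q (by omega)
    have h3 := hcon (r + 1) (by omega) (by omega)
    rw [show j + ((r + 1 : ℕ) : ℤ) = j + 1 + r by push_cast; ring] at h3
    unfold ex at h3
    rw [a1, a2] at h3
    exact hne h3
  obtain ⟨r0, hr1, hrn, hr⟩ := ex1
  have s3 : ∀ d : ℕ, r0 + d ≤ n →
      age k0 e' (j + (r0 + d : ℕ) + 1) = 0 ∧ mode k0 e' (j + (r0 + d : ℕ) + 1) = true := by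
    intro d
    induction d with
    | zero => intro _; exact key r0 hr1 hrn hr
    | succ d ih =>
      intro hd
      obtain ⟨a1, a2⟩ := ih (by omega)
      apply key _ (by omega) hd
      unfold ex
      rw [show j + ((r0 + (d + 1) : ℕ) : ℤ) = j + (r0 + d : ℕ) + 1 by push_cast; ring, a1, a2]
      exact hW0
  have s4 := s3 (n - r0) (by omega)
  rw [show r0 + (n - r0) = n by omega] at s4
  have s5 := s1 n le_rfl
  have s6 : ∀ d : ℕ, (age k0 e (j + n + 1 + d) = age k0 e' (j + n + 1 + d) ∧
      mode k0 e (j + n + 1 + d) = mode k0 e' (j + n + 1 + d)) ∧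
      e (j + n + 1 + d) = e' (j + n + 1 + d) := by
    intro d
    have step : ∀ i : ℤ, age k0 e i = age k0 e' i → mode k0 e i = mode k0 e' i → e i = e' i := by
      intro i h1 h2
      rw [e_eq_swap W (e := e) i, e_eq_swap W (e := e') i, hY]
      unfold ex; rw [h1, h2]
    induction d with
    | zero =>
      have : age k0 e (j + n + 1) = age k0 e' (j + n + 1) ∧
        mode k0 e (j + n + 1) = mode k0 e' (j + n + 1) := by
          rw [s5.1, s5.2, s4.1, s4.2]; simp
      simp only [Nat.cast_zero, add_zero]
      exact ⟨this, step _ this.1 this.2⟩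
    | succ d ih =>
      obtain ⟨⟨a1, a2⟩, a3⟩ := ih
      have : age k0 e (j + n + 1 + d + 1) = age k0 e' (j + n + 1 + d + 1) ∧
        mode k0 e (j + n + 1 + d + 1) = mode k0 e' (j + n + 1 + d + 1) := by
        by_cases hz : e (j + n + 1 + d) = .la k0
        · have hz' := a3 ▸ hz
          rw [age_succ_z he _ hz, age_succ_z he' _ hz', mode_succ_z he _ hz,
            mode_succ_z he' _ hz', a1, a2]; simp
        · have hz' : e' (j + n + 1 + d) ≠ .la k0 := a3 ▸ hz
          rw [age_succ_err _ hz, age_succ_err _ hz', mode_succ_err _ hz, mode_succ_err _ hz', a3]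
          simp
      rw [Nat.cast_add, Nat.cast_one, ← add_assoc]
      exact ⟨this, step _ this.1 this.2⟩
  have := (s6 (i - (j + n + 1)).toNat).2
  rwa [show j + n + 1 + ((i - (j + n + 1)).toNat : ℤ) = i by omega] at this

/-- Heights of the template sequences. -/
def hgt (m : Bool) (k : ℕ) : ℤ := ∑ j ∈ Finset.range k, gS (W m j)

lemma hgt_abs (m : Bool) (k : ℕ) : |hgt W m k| ≤ k := by
  induction k with
  | zero => simp [hgt]
  | succ k ih =>
    unfold hgt at ih ⊢
    rw [Finset.sum_range_succ]
    have h1 := gS_ge (W m k)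
    have h2 := gS_le (W m k)
    rw [abs_le] at ih ⊢
    push_cast
    constructor <;> linarith [ih.1, ih.2]

/-- The potential. -/
def pot (n : ℕ) (m : Bool) (k : ℕ) : ℤ := n * hgt W m (k % n) - (k % n : ℕ)

lemma pot_abs (n : ℕ) (hn : 0 < n) (m : Bool) (k : ℕ) : |pot W n m k| ≤ n * n + n := by
  have h1 := hgt_abs W m (k % n)
  have h2 := Nat.mod_lt k hn
  rw [abs_le] at h1 ⊢
  unfold pot
  have h3 : ((k % n : ℕ) : ℤ) ≤ n := by exact_mod_cast h2.le
  have h4 : (0 : ℤ) ≤ ((k % n : ℕ) : ℤ) := by positivity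
  have h5 : (0 : ℤ) ≤ n := by positivity
  constructor <;> nlinarith [h1.1, h1.2]

lemma pot_step (n : ℕ) (hn : 0 < n) (hper : ∀ m k, W m (k + n) = W m k)
    (hpos : ∀ m, 1 ≤ hgt W m n) (m : Bool) (k : ℕ) :
    pot W n m (k + 1) - pot W n m k + 1 ≤ n * gS (W m k) := by
  have hmod : W m k = W m (k % n) := by
    have : ∀ q r, W m (r + n * q) = W m r := by
      intro q r
      induction q with
      | zero => simp
      | succ q ih => rw [Nat.mul_succ, ← add_assoc, hper, ih]
    conv_lhs => rw [← Nat.mod_add_div k n, this]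
  rw [hmod]
  unfold pot
  have hs : ∀ r, hgt W m (r + 1) = hgt W m r + gS (W m r) := fun r => by
    simp [hgt, Finset.sum_range_succ]
  have h2 := Nat.mod_lt k hn
  rcases Nat.lt_or_ge (k % n + 1) n with h | h
  · have : (k + 1) % n = k % n + 1 := by
      rw [← Nat.mod_add_mod, Nat.mod_eq_of_lt h]
    rw [this, hs]
    push_cast
    linarith
  · have h3 : k % n + 1 = n := by omega
    have : (k + 1) % n = 0 := by rw [← Nat.mod_add_mod, h3, Nat.mod_self]
    rw [this]
    have h4 := hs (k % n)
    rw [h3] at h4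
    have h5 := hpos m
    have h6 : ((k % n : ℕ) : ℤ) = n - 1 := by omega
    have h7 : gS (W m (k % n)) = hgt W m n - hgt W m (k % n) := by linarith
    rw [h7, h6]
    have h8 : hgt W m 0 = 0 := by simp [hgt]
    rw [h8]
    push_cast
    have : (0 : ℤ) < n := by exact_mod_cast hn
    nlinarith

/-- Number of errors in `[i, i + l)`. -/
def nErr (k0 : Fin M) (e : ℤ → AlSym M N) (i : ℤ) (l : ℕ) : ℤ :=
  ∑ r ∈ Finset.range l, if e (i + r) = .la k0 then 0 else 1

/-- Deterministic drift estimate. -/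
lemma drift (n : ℕ) (hn : 0 < n) (hper : ∀ m k, W m (k + n) = W m k)
    (hpos : ∀ m, 1 ≤ hgt W m n) (he : Err k0 e) (x : ℤ → DMSym M N)
    (hx : ∀ i, phS (x i) = Y k0 W e i) (i : ℤ) (l : ℕ) :
    (l : ℤ) - (2 * (n * n + n) + n + 1) * nErr k0 e i l - 2 * (n * n + n)
      ≤ n * (Hfun x (i + l) - Hfun x i) := by
  set B : ℤ := n * n + n with hB
  have hb := fun m k => abs_le.1 (pot_abs W n hn m k)
  suffices h : (l : ℤ) - (2 * B + n + 1) * nErr k0 e i l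
      + pot W n (mode k0 e (i + l)) (age k0 e (i + l)) - pot W n (mode k0 e i) (age k0 e i)
      ≤ n * (Hfun x (i + l) - Hfun x i) by
    linarith [(hb (mode k0 e (i + l)) (age k0 e (i + l))).1, (hb (mode k0 e i) (age k0 e i)).2]
  induction l with
  | zero => simp [nErr]
  | succ l ih =>
    have hs : nErr k0 e i (l + 1) = nErr k0 e i l + if e (i + l) = .la k0 then 0 else 1 := by
      simp [nErr, Finset.sum_range_succ]
    rw [Nat.cast_add, Nat.cast_one, ← add_assoc, Hfun_succ, hs, hx]
    by_cases hz : e (i + l) = .la k0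
    · rw [Y_z W _ hz, age_succ_z he _ hz, mode_succ_z he _ hz, if_pos hz]
      have := pot_step W n hn hper hpos (mode k0 e (i + l)) (age k0 e (i + l))
      unfold ex
      linarith
    · rw [if_neg hz]
      have h1 := (hb (mode k0 e (i + l + 1)) (age k0 e (i + l + 1))).2
      have h2 := (hb (mode k0 e (i + l)) (age k0 e (i + l))).1
      have h3 := gS_ge (Y k0 W e (i + l))
      have h4 : (0 : ℤ) ≤ n := by positivity
      nlinarith

end Automaton

lemma SigmaD_wd' {M N : ℕ} {x : ℤ → DMSym M N} (hx : x ∈ SigmaD M N) (j : ℤ) (l : ℕ) :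
    red (wd x j l) ≠ none := by
  have := SigmaD_wd hx j l
  intro h0
  rw [wd_succ, red_concat, wd_succ, red_concat, h0] at this
  exact this rfl

lemma wd_inj {M N : ℕ} {x x' : ℤ → DMSym M N} {j j' : ℤ} {l : ℕ} (h : wd x j l = wd x' j' l)
    (r : ℕ) (hr : r < l) : x (j + r) = x' (j' + r) := by
  unfold wd at h
  have := List.map_inj_left (l := List.range l) (f := fun n : ℕ => x (j + n))
    (g := fun n : ℕ => x' (j' + n))
  exact this.1 h r (List.mem_range.2 hr)

/-- During an error-free run, the lifted sequence follows the template point. -/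
lemma follow {M N : ℕ} {k0 : Fin M} {e : ℤ → AlSym M N} (he : Err k0 e)
    (xh : Bool → ℤ → DMSym M N) (hxh : ∀ m, xh m ∈ SigmaD M N)
    (hH : ∀ m (k : ℕ), 0 ≤ Hfun (xh m) k) (x : ℤ → DMSym M N) (hxS : x ∈ SigmaD M N)
    (hx : ∀ i, phS (x i) = Y k0 (fun m k => phS (xh m k)) e i) (i : ℤ) (l : ℕ)
    (hz : ∀ r : ℕ, r < l → e (i + r) = .la k0) (r : ℕ) (hr : r < l) :
    x (i + r) = xh (mode k0 e i) (age k0 e i + r : ℕ) := by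
  set j := i - age k0 e i with hj
  have h0 : e (j - 1) ≠ .la k0 := by
    have := age_spec he i
    rwa [show i - 1 - (age k0 e i : ℤ) = j - 1 by rw [hj]; ring] at this
  have a0 : age k0 e j = 0 := by
    have := age_succ_err (j - 1) h0; rwa [sub_add_cancel] at this
  have hz' : ∀ q : ℕ, q < age k0 e i + l → e (j + q) = .la k0 := by
    intro q hq
    rcases Nat.lt_or_ge q (age k0 e i) with h | h
    · have := age_min (k0 := k0) (e := e) i (age k0 e i - 1 - q) (by omega)
      rwa [show i - 1 - ((age k0 e i - 1 - q : ℕ) : ℤ) = j + q by omega] at this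
    · have := hz (q - age k0 e i) (by omega)
      rwa [show i + ((q - age k0 e i : ℕ) : ℤ) = j + q by omega] at this
  have hm : mode k0 e i = mode k0 e j := by
    have := (run_z he j (age k0 e i) fun q hq => hz' q (by omega)).2
    rwa [hj, sub_add_cancel] at this
  have hY : ∀ q : ℕ, q < age k0 e i + l → phS (x (j + q)) = phS (xh (mode k0 e j) q) := by
    intro q hq
    obtain ⟨b1, b2⟩ := run_z he j q fun q' hq' => hz' q' (by omega)
    rw [hx, Y_z _ _ (hz' q hq)]
    unfold ex
    rw [b1, b2, a0]; simp
  obtain ⟨s, hs, -⟩ := red_of_height (hxh (mode k0 e j)) (hH _) (age k0 e i + l)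
  have := word_unique (wd (xh (mode k0 e j)) 0 (age k0 e i + l)) (wd x j (age k0 e i + l)) s
    (by
      unfold wd
      rw [List.map_map, List.map_map]
      apply List.map_congr_left
      intro q hq
      simp only [Function.comp, zero_add]
      exact (hY q (List.mem_range.1 hq)).symm) hs (SigmaD_wd' hxS _ _)
  have h2 := wd_inj this (age k0 e i + r) (by omega)
  rw [hm, show i + (r : ℤ) = j + ((age k0 e i + r : ℕ) : ℤ) by push_cast; rw [hj]; ring, ← h2,
    zero_add]

end HCP

namespace HCP

section Bern
open ProbabilityTheory Measure

variable {A : Type*} [MeasurableSpace A]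

/-- The two-sided i.i.d. product measure. -/
noncomputable def bern (p : Measure A) [IsProbabilityMeasure p] : Measure (ℤ → A) :=
  Measure.infinitePi (fun _ : ℤ => p)

variable (p : Measure A) [IsProbabilityMeasure p]

instance : IsProbabilityMeasure (bern p) := by unfold bern; infer_instance

lemma measurable_shift : Measurable (shift : (ℤ → A) → (ℤ → A)) :=
  measurable_pi_lambda _ fun _ => measurable_pi_apply _

lemma shift_iter {A : Type*} (x : ℤ → A) (n : ℕ) (i : ℤ) : (shift^[n] x) i = x (i + n) := by
  induction n generalizing x i with
  | zero => simp
  | succ n ih =>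
    rw [Function.iterate_succ, Function.comp, ih]
    simp only [shift]
    congr 1; push_cast; ring

lemma mp_shift : MeasurePreserving (shift : (ℤ → A) → (ℤ → A)) (bern p) (bern p) := by
  refine ⟨measurable_shift, ?_⟩
  exact map_infinitePi_infinitePi_of_inj (P := fun _ : ℤ => p) (f := fun i : ℤ => i + 1)
    (fun a b h => by simpa using h)

lemma cyl_indep (I : Finset ℤ) (S : Set (∀ _ : I, A)) (hS : MeasurableSet S) (m : ℕ)
    (hm : Disjoint I (I.map (addRightEmbedding (m : ℤ)))) :
    (bern p) (cylinder (α := fun _ : ℤ => A) I S ∩ shift^[m] ⁻¹' cylinder (α := fun _ : ℤ => A) I S)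
      = (bern p) (cylinder (α := fun _ : ℤ => A) I S) * (bern p) (cylinder (α := fun _ : ℤ => A) I S) := by
  have hI : iIndepFun (fun (i : ℤ) (ω : ℤ → A) => ω i) (bern p) :=
    iIndepFun_infinitePi (P := fun _ : ℤ => p) (X := fun _ ω => ω) (fun i => measurable_id)
  have h2 := hI.indepFun_finset I (I.map (addRightEmbedding (m : ℤ))) hm
    (fun i => measurable_pi_apply i)
  let g : (∀ _ : (I.map (addRightEmbedding (m : ℤ)) : Finset ℤ), A) → (∀ _ : I, A) :=
    fun v i => v ⟨i + m, by simp⟩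
  have hg : Measurable g := measurable_pi_lambda _ fun _ => measurable_pi_apply _
  have h3 := h2.measure_inter_preimage_eq_mul S (g ⁻¹' S) hS (hg hS)
  have e1 : (fun (a : ℤ → A) (i : I) => a i) ⁻¹' S = cylinder (α := fun _ : ℤ => A) I S := rfl
  have e2 : (fun (a : ℤ → A) (i : (I.map (addRightEmbedding (m : ℤ)) : Finset ℤ)) => a i) ⁻¹' (g ⁻¹' S)
      = shift^[m] ⁻¹' cylinder (α := fun _ : ℤ => A) I S := by
    ext a
    simp only [Set.mem_preimage, mem_cylinder]
    have : (g fun i => a i) = I.restrict (shift^[m] a) := by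
      funext i
      simp [g, shift_iter]
    rw [this]
  rw [e1, e2] at h3
  rw [h3, ((mp_shift p).iterate m).measure_preimage (hS.cylinder I).nullMeasurableSet]

lemma exists_disj (I : Finset ℤ) : ∃ m : ℕ, Disjoint I (I.map (addRightEmbedding (m : ℤ))) := by
  obtain ⟨b, hb⟩ := I.finite_toSet.bddAbove
  obtain ⟨a, ha⟩ := I.finite_toSet.bddBelow
  refine ⟨(b - a + 1).toNat, ?_⟩
  rw [Finset.disjoint_left]
  intro x hx hx'
  simp only [Finset.mem_map, addRightEmbedding_apply] at hx'
  obtain ⟨y, hy, rfl⟩ := hx'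
  have h1 := hb hx
  have h2 := ha hy
  have := Int.self_le_toNat (b - a + 1)
  omega

lemma erg_shift : Ergodic (shift : (ℤ → A) → (ℤ → A)) (bern p) := by
  refine ⟨mp_shift p, ⟨fun s hs hinv => ?_⟩⟩
  set P := bern p with hP
  have hinvm : ∀ m : ℕ, shift^[m] ⁻¹' s = s := by
    intro m
    induction m with
    | zero => rfl
    | succ m ih => rw [Function.iterate_succ', Set.preimage_comp, hinv, ih]
  have key : ∀ ε : ℝ, 0 < ε → |P.real s - P.real s ^ 2| ≤ 4 * ε := by
    intro ε hε
    obtain ⟨t, ht, hts⟩ := exists_measure_symmDiff_lt_of_generateFrom_isSetRing (μ := P)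
      (isSetRing_measurableCylinders (α := fun _ : ℤ => A))
      ⟨{Set.univ}, Set.countable_singleton _, by
        rw [Set.singleton_subset_iff]; exact univ_mem_measurableCylinders _, by simp⟩
      generateFrom_measurableCylinders.symm hs (ENNReal.ofReal_pos.2 hε)
    have htm := MeasurableSet.of_mem_measurableCylinders ht
    obtain ⟨I, S, hS, rfl⟩ := (mem_measurableCylinders _).1 ht
    obtain ⟨m, hm⟩ := exists_disj I
    have h1 := cyl_indep p I S hS m hm
    set C := cylinder (α := fun _ : ℤ => A) I S
    have hts' : P.real (symmDiff C s) ≤ ε := by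
      rw [measureReal_def]
      exact ENNReal.toReal_le_of_le_ofReal hε.le hts.le
    have hts2 : P.real (symmDiff (shift^[m] ⁻¹' C) s) ≤ ε := by
      conv_lhs => rw [← hinvm m]
      have : symmDiff (shift^[m] ⁻¹' C) (shift^[m] ⁻¹' s) = shift^[m] ⁻¹' (symmDiff C s) := rfl
      rw [this, measureReal_def, ((mp_shift p).iterate m).measure_preimage
        (htm.symmDiff hs).nullMeasurableSet]
      exact hts'
    have h1' : P.real (C ∩ shift^[m] ⁻¹' C) = P.real C ^ 2 := by
      rw [measureReal_def, h1, ENNReal.toReal_mul, sq, measureReal_def]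
    have htm2 : MeasurableSet (shift^[m] ⁻¹' C) := (measurable_shift.iterate m) htm
    have a1 : |P.real (C ∩ shift^[m] ⁻¹' C) - P.real s| ≤ 2 * ε := by
      refine (abs_measureReal_sub_le_measureReal_symmDiff (htm.inter htm2).nullMeasurableSet hs.nullMeasurableSet).trans ?_
      have : symmDiff (C ∩ shift^[m] ⁻¹' C) s ⊆ symmDiff C s ∪ symmDiff (shift^[m] ⁻¹' C) s := by
        intro x
        simp only [Set.mem_symmDiff, Set.mem_union, Set.mem_inter_iff]
        tauto
      refine (measureReal_mono this).trans ((measureReal_union_le _ _).trans ?_)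
      linarith
    have a2 : |P.real C - P.real s| ≤ ε :=
      (abs_measureReal_sub_le_measureReal_symmDiff htm.nullMeasurableSet hs.nullMeasurableSet).trans hts'
    rw [h1'] at a1
    have b1 : P.real C ≤ 1 := measureReal_le_one
    have b2 : P.real s ≤ 1 := measureReal_le_one
    have b3 : 0 ≤ P.real C := measureReal_nonneg
    have b4 : 0 ≤ P.real s := measureReal_nonneg
    rw [abs_le] at *
    constructor <;> nlinarith
  have h0 : P.real s = P.real s ^ 2 := by
    by_contra h
    have h' : 0 < |P.real s - P.real s ^ 2| := abs_pos.2 (sub_ne_zero.2 h)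
    have := key _ (div_pos h' (by norm_num : (0:ℝ) < 8))
    linarith
  rw [eventuallyConst_set']
  have : P.real s = 0 ∨ P.real s = 1 := by
    have : P.real s * (P.real s - 1) = 0 := by linarith [sq (P.real s)]
    rcases mul_eq_zero.1 this with h | h
    · exact Or.inl h
    · exact Or.inr (by linarith)
  rcases this with h | h
  · left
    rw [ae_eq_empty]
    simpa [measureReal_def, ENNReal.toReal_eq_zero_iff] using h
  · right
    rw [ae_eq_univ, prob_compl_eq_zero_iff hs]
    rw [measureReal_def] at h
    rw [← ENNReal.ofReal_toReal (measure_ne_top P s), h]; simp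

end Bern

end HCP

namespace HCP

section Bern2
open ProbabilityTheory Measure

variable {A : Type*} [MeasurableSpace A] (p : Measure A) [IsProbabilityMeasure p]

lemma bern_word [MeasurableSingletonClass A] (i : ℤ) (w : ℕ → A) (n : ℕ) :
    bern p {e | ∀ r : ℕ, r < n → e (i + r) = w r} = ∏ r ∈ Finset.range n, p {w r} := by
  let emb : ℕ ↪ ℤ := ⟨fun r => i + r, fun a b h => by simpa using h⟩
  have : {e : ℤ → A | ∀ r : ℕ, r < n → e (i + r) = w r}
      = Set.pi ((Finset.range n).map emb : Finset ℤ) (fun j => {w (j - i).toNat}) := by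
    ext e
    have hemb : ∀ r, emb r = i + r := fun _ => rfl
    simp [Set.mem_pi, hemb]
  rw [this, bern, infinitePi_pi _ (fun _ _ => measurableSet_singleton _), Finset.prod_map]
  have hemb : ∀ r, emb r = i + r := fun _ => rfl
  simp [hemb]

lemma meas_word [MeasurableSingletonClass A] (i : ℤ) (w : ℕ → A) (n : ℕ) :
    MeasurableSet {e : ℤ → A | ∀ r : ℕ, r < n → e (i + r) = w r} := by
  simp only [Set.ofPred_forall]
  exact MeasurableSet.iInter fun r => MeasurableSet.iInter fun _ =>
    measurable_pi_apply (i + (r:ℤ)) (measurableSet_singleton _)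

lemma inf_often [MeasurableSingletonClass A] (c : A) (hc : p {c} ≠ 0) (n : ℕ) :
    ∀ᵐ e ∂(bern p), ∀ i : ℤ, ∃ j ≤ i, ∀ r : ℕ, r ≤ n → e (j + r) = c := by
  let D : ℤ → Set (ℤ → A) := fun j => {e | ∀ r : ℕ, r < n + 1 → e (j + r) = c}
  have hD : ∀ j, MeasurableSet (D j) := fun j => meas_word j (fun _ => c) (n+1)
  have hDP : ∀ j, bern p (D j) = p {c} ^ (n+1) := fun j => by
    rw [bern_word p j (fun _ => c) (n+1)]; simp
  let B : ℕ → Set (ℤ → A) := fun k => ⋃ j : {j : ℤ // j ≤ -(k:ℤ)}, D j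
  have hB : ∀ k, MeasurableSet (B k) := fun k => MeasurableSet.iUnion fun _ => hD _
  let G := ⋂ k, B k
  have hG : MeasurableSet G := MeasurableSet.iInter hB
  have memG : ∀ e, e ∈ G ↔ ∀ i : ℤ, ∃ j ≤ i, ∀ r : ℕ, r ≤ n → e (j + r) = c := by
    intro e
    simp only [G, B, D, Set.mem_iInter, Set.mem_iUnion, Subtype.exists, Nat.lt_succ_iff, Set.mem_ofPred_eq]
    constructor
    · intro h i
      obtain ⟨j, hj, h⟩ := h (-i).toNat
      exact ⟨j, by have := Int.self_le_toNat (-i); omega, h⟩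
    · intro h k
      obtain ⟨j, hj, h⟩ := h (-k)
      exact ⟨j, hj, h⟩
  have hinv : shift ⁻¹' G = G := by
    ext e
    rw [Set.mem_preimage, memG, memG]
    constructor
    · intro h i
      obtain ⟨j, hj, h⟩ := h (i - 1)
      refine ⟨j + 1, by omega, fun r hr => ?_⟩
      rw [← h r hr]; simp only [shift]; congr 1; ring
    · intro h i
      obtain ⟨j, hj, h⟩ := h (i + 1)
      refine ⟨j - 1, by omega, fun r hr => ?_⟩
      rw [← h r hr]; simp only [shift]; congr 1; ring
  have hanti : Antitone B := by
    intro a b hab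
    refine Set.iUnion_subset fun j => ?_
    exact Set.subset_iUnion (fun j : {j : ℤ // j ≤ -(a:ℤ)} => D j) ⟨j, by have := j.2; omega⟩
  have hpos : bern p G ≠ 0 := by
    rw [hanti.measure_iInter (fun k => (hB k).nullMeasurableSet) ⟨0, measure_ne_top _ _⟩]
    have : p {c} ^ (n+1) ≤ ⨅ k, bern p (B k) := le_iInf fun k => by
      rw [← hDP (-(k:ℤ))]
      exact measure_mono (Set.subset_iUnion (fun j : {j : ℤ // j ≤ -(k:ℤ)} => D j) ⟨_, le_refl _⟩)
    intro h0
    rw [h0] at this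
    exact pow_ne_zero _ hc (le_antisymm this zero_le)
  have h1 : bern p G = 1 := ((erg_shift p).toPreErgodic.prob_eq_zero_or_one hG hinv).resolve_left hpos
  have : ∀ᵐ e ∂(bern p), e ∈ G := (mem_ae_iff_prob_eq_one hG).2 h1
  filter_upwards [this] with e he
  exact (memG e).1 he

lemma slln (S : Set A) (hS : MeasurableSet S) (f : ℕ → ℤ) (hf : Function.Injective f) :
    ∀ᵐ e ∂(bern p), Tendsto (fun l : ℕ => (∑ i ∈ Finset.range l, S.indicator (fun _ => (1:ℝ)) (e (f i))) / l)
      atTop (𝓝 (p.real S)) := by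
  have hI : iIndepFun (fun (i : ℤ) (ω : ℤ → A) => ω i) (bern p) :=
    iIndepFun_infinitePi (P := fun _ : ℤ => p) (X := fun _ ω => ω) (fun i => measurable_id)
  have hm : Measurable (S.indicator (fun _ => (1:ℝ))) := measurable_const.indicator hS
  have he : ∀ i : ℤ, (bern p).map (fun e : ℤ → A => e i) = p := fun i =>
    infinitePi_map_eval (fun _ : ℤ => p) i
  have := strong_law_ae_real (μ := bern p) (fun i e => S.indicator (fun _ => (1:ℝ)) (e (f i)))
    ?_ ?_ ?_
  · have h2 : (bern p)[fun e => S.indicator (fun _ => (1:ℝ)) (e (f 0))] = p.real S := by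
      rw [← integral_map (φ := fun e : ℤ → A => e (f 0)) (measurable_pi_apply _).aemeasurable
        (f := S.indicator (fun _ => (1:ℝ))) hm.aestronglyMeasurable, he]
      rw [integral_indicator_const _ hS]; simp
    rw [h2] at this
    exact this
  · refine (integrable_const (1:ℝ)).mono' (hm.comp (measurable_pi_apply _)).aestronglyMeasurable ?_
    refine Eventually.of_forall fun e => ?_
    by_cases h : e (f 0) ∈ S <;> simp [h]
  · intro i j hij
    exact (hI.indepFun (hf.ne hij)).comp hm hm
  · intro i
    refine ⟨(hm.comp (measurable_pi_apply _)).aemeasurable, (hm.comp (measurable_pi_apply _)).aemeasurable, ?_⟩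
    have : ∀ i : ℤ, (bern p).map (fun e : ℤ → A => S.indicator (fun _ => (1:ℝ)) (e i)) = p.map (S.indicator (fun _ => (1:ℝ))) := by
      intro i
      conv_rhs => rw [← he i, map_map hm (measurable_pi_apply i)]
      rfl
    rw [this, this]

end Bern2

end HCP

namespace HCP

/-- Two periodic templates. -/
structure Tm (M N : ℕ) where
  k0 : Fin M
  xh : Bool → ℤ → DMSym M N
  n : ℕ
  hn : 0 < n
  mem : ∀ m, xh m ∈ SigmaD M N
  per : ∀ m i, xh m (i + n) = xh m i
  hH : ∀ m (k : ℕ), 0 ≤ Hfun (xh m) k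
  hpos : ∀ m, 1 ≤ Hfun (xh m) n

namespace Tm
variable {M N : ℕ} (T : Tm M N)

/-- The projected templates. -/
def W : Bool → ℕ → AlSym M N := fun m k => phS (T.xh m k)

/-- The drift constant. -/
def K : ℤ := 2 * (T.n * T.n + T.n) + T.n + 1

lemma K_pos : 0 < T.K := by
  have := T.hn
  unfold K; positivity

lemma hgt_eq (m : Bool) (k : ℕ) : hgt T.W m k = Hfun (T.xh m) k := by
  induction k with
  | zero => simp [hgt, Hfun_zero]
  | succ k ih =>
    rw [hgt, Finset.sum_range_succ, ← hgt, ih]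
    push_cast
    rw [Hfun_succ]; rfl

lemma W_per (m : Bool) (k : ℕ) : T.W m (k + T.n) = T.W m k := by
  simp only [W]; push_cast; rw [T.per]

lemma W_zero (m : Bool) : T.W m 0 ≠ .b := by
  intro h
  have h1 := T.hH m 1
  rw [← T.hgt_eq] at h1
  simp [hgt, h, gS] at h1

lemma Hfun_per (m : Bool) (k : ℕ) : Hfun (T.xh m) ((k + T.n : ℕ):ℤ) = Hfun (T.xh m) k + Hfun (T.xh m) T.n := by
  induction k with
  | zero => simp [Hfun_zero]
  | succ k ih =>
    have h1 := Hfun_succ (T.xh m) ((k + T.n : ℕ) : ℤ)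
    have h2 := Hfun_succ (T.xh m) (k : ℤ)
    have h3 := T.per m k
    push_cast at *
    rw [h3] at h1
    rw [show (k:ℤ) + 1 + T.n = k + T.n + 1 by ring, h1, h2, ih]; ring

lemma W_ne (m : Bool) (k : ℕ) : ∃ r, r < T.n ∧ T.W m (k + r) ≠ .b := by
  by_contra hcon
  push Not at hcon
  have h : ∀ r ≤ T.n, Hfun (T.xh m) ((k + r : ℕ):ℤ) = Hfun (T.xh m) k - r := by
    intro r hr
    induction r with
    | zero => simp
    | succ r ih =>
      have h1 := Hfun_succ (T.xh m) ((k + r : ℕ) : ℤ)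
      have h2 := hcon r (by omega)
      simp only [W] at h2
      rw [h2, ih (by omega)] at h1
      simp only [gS] at h1
      push_cast at *
      rw [← add_assoc, h1]; ring
  have h1 := h T.n le_rfl
  rw [Hfun_per] at h1
  have := T.hpos m
  have := T.hn
  omega

/-- The set of good error sequences. -/
def Good : Set (ℤ → AlSym M N) :=
  {e | (∀ i : ℤ, ∃ j ≤ i, ∀ r : ℕ, r ≤ T.n → e (j + r) = .b) ∧
    Tendsto (fun l : ℕ => (l:ℤ) - T.K * nErr T.k0 e 0 l) atTop atTop ∧
    Tendsto (fun l : ℕ => (l:ℤ) - T.K * nErr T.k0 e (-(l:ℤ)) l) atTop atTop}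

variable {T}

lemma Good.err {e} (h : e ∈ T.Good) : Err T.k0 e := by
  intro i
  obtain ⟨j, hj, h⟩ := h.1 (i - 1)
  refine ⟨(i - 1 - j).toNat, ?_⟩
  rw [Int.toNat_of_nonneg (by omega)]
  have := h 0 (by omega)
  simp at this
  simp [this]

lemma Good.tend {e} (h : e ∈ T.Good) :
    Tendsto (Hfun (lift T.k0 (Y T.k0 T.W e))) atTop atTop ∧
    Tendsto (Hfun (lift T.k0 (Y T.k0 T.W e))) atBot atBot := by
  have hd := drift T.W T.n T.hn T.W_per (fun m => by rw [T.hgt_eq]; exact T.hpos m) (Good.err h)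
    (lift T.k0 (Y T.k0 T.W e)) (fun i => phS_lift _ _ i)
  set x := lift T.k0 (Y T.k0 T.W e)
  have hn : (0:ℤ) < T.n := by exact_mod_cast T.hn
  have aux : ∀ (a b : ℕ → ℤ), Tendsto a atTop atTop → (∀ l, a l - 2 * (T.n * T.n + T.n) ≤ T.n * b l) →
      Tendsto b atTop atTop := by
    intro a b ha hab
    rw [tendsto_atTop]
    intro c
    filter_upwards [(tendsto_atTop.1 ha) (T.n * c + 2 * (T.n * T.n + T.n))] with l hl
    have := hab l
    nlinarith
  constructor
  · have h1 : Tendsto (fun l : ℕ => Hfun x l) atTop atTop := by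
      refine aux _ _ h.2.1 fun l => ?_
      have := hd 0 l
      rw [Hfun_zero, zero_add, sub_zero] at this
      exact this
    have h2 : Tendsto (Hfun x) (map ((↑) : ℕ → ℤ) atTop) atTop := tendsto_map'_iff.2 h1
    rwa [Nat.map_cast_int_atTop] at h2
  · have h1 : Tendsto (fun l : ℕ => - Hfun x (-(l:ℤ))) atTop atTop := by
      refine aux _ _ h.2.2 fun l => ?_
      have := hd (-(l:ℤ)) l
      rw [neg_add_cancel, Hfun_zero, zero_sub] at this
      exact this
    have h2 : Tendsto (fun i : ℤ => - Hfun x (-i)) atTop atTop := by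
      have h2 : Tendsto (fun i : ℤ => - Hfun x (-i)) (map ((↑) : ℕ → ℤ) atTop) atTop :=
        tendsto_map'_iff.2 h1
      rwa [Nat.map_cast_int_atTop] at h2
    have h3 := tendsto_neg_atTop_atBot.comp (h2.comp tendsto_neg_atBot_atTop)
    refine h3.congr fun i => ?_
    simp

lemma Good.stk {e} (h : e ∈ T.Good) (i : ℤ) : ∃ n, stkAt (Y T.k0 T.W e) i n ≠ [] :=
  exists_stkAt T.k0 _ (Good.tend h).2 i

lemma Good.lift_mem {e} (h : e ∈ T.Good) : lift T.k0 (Y T.k0 T.W e) ∈ SigmaD M N :=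
  HCP.lift_mem _ _ (Good.stk h)

variable (T)

open Classical in
/-- The coding map. -/
noncomputable def F (e : ℤ → AlSym M N) : ↥(SigmaD M N) :=
  if h : e ∈ T.Good then ⟨_, Good.lift_mem h⟩ else ⟨_, T.mem true⟩

variable {T}
lemma F_val {e} (h : e ∈ T.Good) : (T.F e).val = lift T.k0 (Y T.k0 T.W e) := by
  rw [F, dif_pos h]

lemma phS_F {e} (h : e ∈ T.Good) (i : ℤ) : phS ((T.F e).val i) = Y T.k0 T.W e i := by
  rw [F_val h, phS_lift]

lemma F_inj : Set.InjOn T.F T.Good := by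
  intro e he e' he' h
  refine Y_inj T.W T.n (T.W_zero true) T.W_ne (Good.err he) (Good.err he') he.1 ?_
  funext i
  rw [← phS_F he, ← phS_F he', h]

lemma F_mem_A {e} (h : e ∈ T.Good) : (T.F e).val ∈ AalphaSet M N :=
  ⟨(T.F e).2, by rw [F_val h]; exact Good.tend h⟩

lemma F_shift {e} (h : e ∈ T.Good) (h' : shift e ∈ T.Good) : T.F (shift e) = shiftD M N (T.F e) := by
  apply Subtype.ext
  rw [F_val h', Y_shift, lift_shift, ← F_val h]
  rfl

lemma evt_apply (e : ℤ → AlSym M N) (i : ℤ) : ∀ᶠ e' in 𝓝 e, e' i = e i :=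
  (continuous_apply i).continuousAt.eventually_mem ((isOpen_discrete {e i}).mem_nhds rfl)

lemma Y_evt {e} (he : Err T.k0 e) (i : ℤ) : ∀ᶠ e' in 𝓝 e, Y T.k0 T.W e' i = Y T.k0 T.W e i := by
  have : ∀ᶠ e' in 𝓝 e, ∀ r ∈ Finset.range (age T.k0 e i + 2), e' (i - r) = e (i - r) := by
    rw [Filter.eventually_all_finset]
    exact fun r _ => evt_apply e _
  filter_upwards [this] with e' h
  exact Y_congr T.W he i e' fun r hr => h r (Finset.mem_range.2 (by omega))

lemma lift_evt {e} (he : e ∈ T.Good) (i : ℤ) :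
    ∀ᶠ e' in 𝓝 e, lift T.k0 (Y T.k0 T.W e') i = lift T.k0 (Y T.k0 T.W e) i := by
  obtain ⟨n, hn⟩ := Good.stk he i
  have : ∀ᶠ e' in 𝓝 e, ∀ r ∈ Finset.range n, Y T.k0 T.W e' (i - n + r) = Y T.k0 T.W e (i - n + r) := by
    rw [Filter.eventually_all_finset]
    exact fun r _ => Y_evt (Good.err he) _
  filter_upwards [this, Y_evt (Good.err he) i] with e' h h0
  have hs : stkAt (Y T.k0 T.W e') i n = stkAt (Y T.k0 T.W e) i n :=
    stkRun_congr _ _ _ _ _ fun r hr => h r (Finset.mem_range.2 hr)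
  rw [lift_eq _ _ i n hn, lift_eq _ _ i n (by rw [hs]; exact hn), hs, h0]

lemma F_cont : ContinuousOn T.F T.Good := by
  rw [continuousOn_iff_continuous_domRestrict, continuous_induced_rng, continuous_pi_iff]
  intro i
  rw [continuous_iff_continuousAt]
  intro e
  have h1 : ∀ᶠ e' in 𝓝 e, (T.F e'.1).val i = (T.F e.1).val i := by
    have := (continuous_subtype_val.tendsto e).eventually (lift_evt e.2 i)
    filter_upwards [this] with e' h
    rw [F_val e'.2, F_val e.2, h]
  exact (tendsto_congr' h1).2 tendsto_const_nhds

lemma meas_nErr (k0 : Fin M) (i : ℤ) (l : ℕ) : Measurable (fun e : ℤ → AlSym M N => nErr k0 e i l) := by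
  unfold nErr
  refine Finset.measurable_sum _ fun r _ => ?_
  exact (measurable_of_countable (fun a : AlSym M N => if a = .la k0 then (0:ℤ) else 1)).comp
    (measurable_pi_apply _)

lemma Good_meas : MeasurableSet T.Good := by
  have h1 : MeasurableSet {e : ℤ → AlSym M N | ∀ i : ℤ, ∃ j ≤ i, ∀ r : ℕ, r ≤ T.n → e (j + r) = .b} := by
    simp only [Set.ofPred_forall, Set.ofPred_exists, Set.ofPred_and]
    refine MeasurableSet.iInter fun i => MeasurableSet.iUnion fun j => ?_
    refine (MeasurableSet.const _).inter ?_
    refine MeasurableSet.iInter fun r => MeasurableSet.iInter fun _ => ?_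
    have hb : MeasurableSet ({AlSym.b} : Set (AlSym M N)) := MeasurableSet.of_discrete
    exact (measurable_pi_apply (X := fun _ : ℤ => AlSym M N) (j + (r:ℤ))) hb
  have h2 : MeasurableSet {e : ℤ → AlSym M N | Tendsto (fun l : ℕ => (l:ℤ) - T.K * nErr T.k0 e 0 l) atTop atTop} :=
    measurableSet_tendsto _ fun l => measurable_const.sub (measurable_const.mul (meas_nErr _ _ _))
  have h3 : MeasurableSet {e : ℤ → AlSym M N | Tendsto (fun l : ℕ => (l:ℤ) - T.K * nErr T.k0 e (-(l:ℤ)) l) atTop atTop} :=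
    measurableSet_tendsto _ fun l => measurable_const.sub (measurable_const.mul (meas_nErr _ _ _))
  exact h1.inter (h2.inter h3)

lemma F_meas : Measurable T.F := by
  classical
  have : T.F = T.Good.piecewise T.F (fun _ => ⟨_, T.mem true⟩) := by
    funext e
    by_cases h : e ∈ T.Good
    · rw [Set.piecewise_eq_of_mem _ _ _ h]
    · rw [Set.piecewise_eq_of_notMem _ _ _ h, F, dif_neg h]
  rw [this]
  exact F_cont.measurable_piecewise continuousOn_const Good_meas

end Tm
end HCP

namespace HCP
namespace Tm
variable {M N : ℕ} (T : Tm M N)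

/-- Admissible site laws. -/
structure Adm (p : Measure (AlSym M N)) : Prop where
  pos : ∀ a, p {a} ≠ 0
  small : (T.K : ℝ) * p.real {AlSym.la T.k0}ᶜ < 1

variable {T} {p : Measure (AlSym M N)} [IsProbabilityMeasure p]

lemma nErr_ind (k0 : Fin M) (e : ℤ → AlSym M N) (i : ℤ) (l : ℕ) :
    ((nErr k0 e i l : ℤ) : ℝ) = ∑ r ∈ Finset.range l,
      ({AlSym.la k0}ᶜ : Set (AlSym M N)).indicator (fun _ => (1:ℝ)) (e (i + r)) := by
  unfold nErr
  push_cast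
  refine Finset.sum_congr rfl fun r _ => ?_
  by_cases h : e (i + r) = .la k0 <;> simp [h]

lemma nErr_refl (k0 : Fin M) (e : ℤ → AlSym M N) (l : ℕ) :
    ((nErr k0 e (-(l:ℤ)) l : ℤ) : ℝ) = ∑ r ∈ Finset.range l,
      ({AlSym.la k0}ᶜ : Set (AlSym M N)).indicator (fun _ => (1:ℝ)) (e (-1 - (r:ℤ))) := by
  rw [nErr_ind, ← Finset.sum_range_reflect]
  refine Finset.sum_congr rfl fun r hr => ?_
  have := Finset.mem_range.1 hr
  congr 2
  have : ((l - 1 - r : ℕ) : ℤ) = l - 1 - r := by omega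
  rw [this]; ring

lemma tend_of_avg (a : ℕ → ℤ) (K : ℤ) (η : ℝ) (hη : (K:ℝ) * η < 1)
    (h : Tendsto (fun l : ℕ => (a l : ℝ) / l) atTop (𝓝 η)) :
    Tendsto (fun l : ℕ => (l:ℤ) - K * a l) atTop atTop := by
  have h1 : Tendsto (fun l : ℕ => (1 - K * ((a l : ℝ) / l))) atTop (𝓝 (1 - K * η)) :=
    tendsto_const_nhds.sub (h.const_mul _)
  have h2 := h1.pos_mul_atTop (by linarith) (tendsto_natCast_atTop_atTop (R := ℝ))
  rw [← tendsto_intCast_atTop_iff (R := ℝ)]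
  refine h2.congr' ?_
  filter_upwards [eventually_gt_atTop 0] with l hl
  have : (l:ℝ) ≠ 0 := by positivity
  push_cast
  field_simp

lemma good_ae (hp : T.Adm p) : ∀ᵐ e ∂(bern p), e ∈ T.Good := by
  have hS : MeasurableSet ({AlSym.la T.k0}ᶜ : Set (AlSym M N)) := MeasurableSet.of_discrete
  filter_upwards [inf_often p AlSym.b (hp.pos _) T.n,
    slln p _ hS (fun r => (0:ℤ) + r) (fun a b h => by simpa using h),
    slln p _ hS (fun r => -1 - (r:ℤ)) (fun a b h => by simpa using h)] with e h1 h2 h3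
  refine ⟨h1, ?_, ?_⟩
  · refine tend_of_avg _ _ _ hp.small ?_
    simp only [nErr_ind]
    exact h2
  · refine tend_of_avg _ _ _ hp.small ?_
    simp only [nErr_refl]
    exact h3

variable (T p)
/-- The coded measure. -/
noncomputable def nu : ProbabilityMeasure ↥(SigmaD M N) :=
  ⟨(bern p).map T.F, Measure.isProbabilityMeasure_map F_meas.aemeasurable⟩

variable {T p}
lemma nu_coe : (T.nu p).toMeasure = (bern p).map T.F := rfl

lemma good_ae2 (hp : T.Adm p) : ∀ᵐ e ∂(bern p), e ∈ T.Good ∧ shift e ∈ T.Good :=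
  (good_ae hp).and ((mp_shift p).quasiMeasurePreserving.ae (good_ae hp))

lemma F_semi (hp : T.Adm p) : ∀ᵐ e ∂(bern p), T.F (shift e) = shiftD M N (T.F e) := by
  filter_upwards [good_ae2 hp] with e h using F_shift h.1 h.2

lemma cont_shiftD : Continuous (shiftD M N) := by
  rw [continuous_induced_rng, continuous_pi_iff]
  intro i
  exact (continuous_apply (i+1)).comp continuous_subtype_val

lemma nu_mp (hp : T.Adm p) : MeasurePreserving (shiftD M N) (T.nu p).toMeasure (T.nu p).toMeasure := by
  refine ⟨cont_shiftD.measurable, ?_⟩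
  rw [nu_coe, Measure.map_map cont_shiftD.measurable F_meas]
  conv_rhs => rw [← (mp_shift p).map_eq, Measure.map_map F_meas measurable_shift]
  refine Measure.map_congr ?_
  filter_upwards [F_semi hp] with e h
  simp [h]

lemma nu_erg (hp : T.Adm p) : T.nu p ∈ MergD M N := by
  refine ⟨nu_mp hp, ⟨fun s hs hinv => ?_⟩⟩
  have h1 : shift ⁻¹' (T.F ⁻¹' s) =ᵐ[bern p] T.F ⁻¹' s := by
    rw [eventuallyEq_set]
    filter_upwards [F_semi hp] with e h
    rw [Set.mem_preimage, Set.mem_preimage, h, ← Set.mem_preimage, hinv]; rfl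
  rw [eventuallyConst_set', nu_coe]
  rcases (erg_shift p).quasiErgodic.ae_empty_or_univ₀ (F_meas hs).nullMeasurableSet h1 with h | h
  · left
    rw [ae_eq_empty] at *
    rwa [Measure.map_apply F_meas hs]
  · right
    rw [ae_eq_univ] at *
    rwa [Measure.map_apply F_meas hs.compl]

lemma nu_MeAl (hp : T.Adm p) : T.nu p ∈ MeAl M N := by
  refine ⟨nu_erg hp, le_antisymm prob_le_one ?_⟩
  rw [nu_coe]
  refine le_trans ?_ (Measure.le_map_apply F_meas.aemeasurable _)
  have : (bern p) T.Good = 1 := (mem_ae_iff_prob_eq_one Good_meas).1 (good_ae hp)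
  rw [← this]
  exact measure_mono fun e he => F_mem_A he

end Tm
end HCP

namespace HCP
namespace Tm
variable {M N : ℕ} {T : Tm M N} {p : Measure (AlSym M N)} [IsProbabilityMeasure p]

lemma exists_inv : ∃ g : ↥(SigmaD M N) → (ℤ → AlSym M N), Measurable g ∧ ∀ e ∈ T.Good, g (T.F e) = e := by
  have : StandardBorelSpace T.Good := Good_meas.standardBorel
  have hemb : MeasurableEmbedding (fun e : T.Good => T.F e.1) :=
    Measurable.measurableEmbedding (F_meas.comp measurable_subtype_coe)
      (fun a b h => Subtype.ext (F_inj a.2 b.2 h))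
  obtain ⟨g, hg, h⟩ := hemb.exists_measurable_extend (g := fun e : T.Good => e.1)
    measurable_subtype_coe (fun _ => ⟨fun _ => AlSym.b⟩)
  exact ⟨g, hg, fun e he => congrFun h ⟨e, he⟩⟩

lemma map_inv (hp : T.Adm p) {g : ↥(SigmaD M N) → (ℤ → AlSym M N)} (hg : Measurable g)
    (h : ∀ e ∈ T.Good, g (T.F e) = e) : (T.nu p).toMeasure.map g = bern p := by
  rw [nu_coe, Measure.map_map hg F_meas]
  conv_rhs => rw [← Measure.map_id (μ := bern p)]
  refine Measure.map_congr ?_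
  filter_upwards [good_ae hp] with e he using h e he

lemma nu_inj {q : Measure (AlSym M N)} [IsProbabilityMeasure q] (hp : T.Adm p) (hq : T.Adm q)
    (h : T.nu p = T.nu q) : p = q := by
  obtain ⟨g, hg, hgi⟩ := exists_inv (T := T)
  have h1 : bern p = bern q := by rw [← map_inv hp hg hgi, ← map_inv hq hg hgi, h]
  rw [← Measure.infinitePi_map_eval (fun _ : ℤ => p) 0, ← Measure.infinitePi_map_eval (fun _ : ℤ => q) 0]
  change (bern p).map _ = (bern q).map _
  rw [h1]

lemma nu_bern (hp : T.Adm p) : IsBernoulli (shiftD M N) (T.nu p).toMeasure := by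
  obtain ⟨g, hg, hgi⟩ := exists_inv (T := T)
  let enc : AlSym M N → ℕ := fun a => Fintype.equivFin _ a
  have hinj : Function.Injective enc := fun a a₁ h =>
    (Fintype.equivFin _).injective (Fin.ext h)
  have : Nonempty (AlSym M N) := ⟨.b⟩
  let dec : ℕ → AlSym M N := Function.invFun enc
  have hde : ∀ a, dec (enc a) = a := Function.leftInverse_invFun hinj
  have hm : Measurable enc := measurable_of_countable _
  have hm2 : Measurable dec := measurable_of_countable _
  have : IsProbabilityMeasure (p.map enc) := Measure.isProbabilityMeasure_map hm.aemeasurable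
  have hE : Measurable (fun (e : ℤ → AlSym M N) i => enc (e i)) :=
    measurable_pi_lambda _ fun i => hm.comp (measurable_pi_apply i)
  have hD : Measurable (fun (e : ℤ → ℕ) i => dec (e i)) :=
    measurable_pi_lambda _ fun i => hm2.comp (measurable_pi_apply i)
  have hmap : (bern p).map (fun e i => enc (e i)) = bern (p.map enc) :=
    Measure.infinitePi_map_pi (fun _ : ℤ => p) (f := fun _ => enc) (fun _ => hm)
  have hφ : (T.nu p).toMeasure.map (fun x i => enc (g x i)) = bern (p.map enc) := by
    rw [← hmap, ← map_inv hp hg hgi, Measure.map_map hE hg]; rfl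
  refine ⟨fun n => p.map enc {n}, bern (p.map enc), ?_, inferInstance, ?_, fun x i => enc (g x i),
    fun y => T.F (fun i => dec (y i)), hE.comp hg, F_meas.comp hD, hφ, ?_, ?_, ?_, ?_⟩
  · have := tsum_measure_preimage_singleton (μ := p.map enc) (s := Set.univ) Set.countable_univ
      (f := id) (fun _ _ => MeasurableSet.of_discrete)
    simp only [Set.preimage_id, measure_univ] at this
    rw [← this, tsum_univ (fun n => (p.map enc) {n})]
  · intro n w j
    rcases Nat.eq_zero_or_pos n with rfl | hn
    · simp
    have h1 := bern_word (p.map enc) j (fun r => w ⟨r % n, Nat.mod_lt _ hn⟩) n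
    rw [Finset.prod_range] at h1
    have h2 : {y : ℤ → ℕ | ∀ i : Fin n, y (j + (i:ℕ)) = w i} =
        {e | ∀ r : ℕ, r < n → e (j + r) = w ⟨r % n, Nat.mod_lt _ hn⟩} := by
      ext y
      simp only [Set.mem_ofPred_eq]
      constructor
      · intro h r hr
        rw [h ⟨r, hr⟩]; congr 1; ext; simp [Nat.mod_eq_of_lt hr]
      · intro h i
        rw [h i i.2]; congr 1; ext; simp [Nat.mod_eq_of_lt i.2]
    rw [h2, h1]
    refine Finset.prod_congr rfl fun i _ => ?_
    congr 3; ext; simp [Nat.mod_eq_of_lt i.2]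
  · rw [← hmap]
    refine (Measure.map_map (F_meas.comp hD) hE).trans ?_
    simp only [Function.comp_def, hde]
    rfl
  · rw [nu_coe]
    have : ∀ᵐ e ∂(bern p), T.F (fun i => dec (enc (g (T.F e) i))) = T.F e := by
      filter_upwards [good_ae hp] with e he
      simp [hde, hgi e he]
    exact (ae_map_iff F_meas.aemeasurable (measurableSet_eq_fun
      (F_meas.comp (hD.comp (hE.comp hg))) measurable_id)).2 this
  · rw [← hmap]
    refine (ae_map_iff hE.aemeasurable (measurableSet_eq_fun
      (hE.comp (hg.comp (F_meas.comp hD))) measurable_id)).2 ?_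
    filter_upwards [good_ae hp] with e he
    simp [hde, hgi e he]
  · rw [nu_coe]
    refine (ae_map_iff F_meas.aemeasurable (measurableSet_eq_fun
      (hE.comp (hg.comp cont_shiftD.measurable)) (measurable_shift.comp (hE.comp hg)))).2 ?_
    filter_upwards [good_ae2 hp] with e he
    simp only [Function.comp]
    rw [← F_shift he.1 he.2, hgi _ he.2, hgi _ he.1]
    rfl

lemma exists_code (j : ℤ) (y : ℕ → AlSym M N) (L : ℕ) : ∃ e : ℤ → AlSym M N, (∀ i < j, e i = .b) ∧
    ∀ r < L, Y T.k0 T.W e (j + r) = y r := by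
  induction L with
  | zero => exact ⟨fun _ => .b, fun _ _ => rfl, fun r hr => absurd hr (by omega)⟩
  | succ L ih =>
    obtain ⟨e, h1, h2⟩ := ih
    set c := Equiv.swap (.la T.k0) (ex T.k0 T.W e (j + L)) (y L)
    have herr : Err T.k0 e := fun i => ⟨(i - 1 - (j - 1)).natAbs, by
      rw [h1 _ (by omega)]; simp⟩
    refine ⟨Function.update e (j + L) c, fun i hi => ?_, fun r hr => ?_⟩
    · rw [Function.update_of_ne (by omega), h1 i hi]
    · rcases Nat.lt_succ_iff_lt_or_eq.1 hr with hr | rfl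
      · rw [← h2 r hr]
        refine Y_congr T.W herr _ _ fun q _ => ?_
        rw [Function.update_of_ne (by omega)]
      · have hage : age T.k0 (Function.update e (j + r) c) (j + r) = age T.k0 e (j + r) := by
          unfold age
          congr 1
          ext k
          simp only [Set.mem_ofPred_eq]
          rw [Function.update_of_ne (by omega)]
        have hmode : mode T.k0 (Function.update e (j + r) c) (j + r) = mode T.k0 e (j + r) := by
          unfold mode
          rw [hage, Function.update_of_ne (by omega)]
        have hex : ex T.k0 T.W (Function.update e (j + r) c) (j + r) = ex T.k0 T.W e (j + r) := by
          unfold ex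
          rw [hage, hmode]
        unfold Y
        rw [hex, Function.update_self]
        simp [c]

lemma exists_window (U : Set ↥(SigmaD M N)) (hU : IsOpen U) (x0 : ↥(SigmaD M N)) (hx0 : x0 ∈ U) :
    ∃ R : ℕ, ∀ x : ↥(SigmaD M N), (∀ i : ℤ, -(R:ℤ) ≤ i → i ≤ R → x.1 i = x0.1 i) → x ∈ U := by
  obtain ⟨V, hV, rfl⟩ := isOpen_induced_iff.1 hU
  obtain ⟨I, u, hu, hsub⟩ := isOpen_pi_iff.1 hV x0.1 hx0
  obtain ⟨b, hb⟩ := (I.image Int.natAbs).finite_toSet.bddAbove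
  refine ⟨b, fun x hx => hsub ?_⟩
  intro i hi
  have hi' : i.natAbs ≤ b := hb (by simp only [Finset.coe_image]; exact ⟨i, hi, rfl⟩)
  rw [hx i (by omega) (by omega)]
  exact (hu i hi).2

lemma nu_full (hp : T.Adm p) : FullSupp (T.nu p) := by
  intro U hU ⟨x0, hx0⟩
  obtain ⟨R, hR⟩ := exists_window U hU x0 hx0
  obtain ⟨pr, s, hpr⟩ := exists_initial (wd x0.1 (-(R:ℤ)) (2*R+1)) (SigmaD_wd' x0.2 _ _)
  set j : ℤ := -(R:ℤ) - pr.length with hj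
  set L := pr.length + (2*R+1) with hL
  let x1 : ℤ → DMSym M N := fun i => if i < -(R:ℤ) then pr.getD (i - j).toNat (.la T.k0) else x0.1 i
  have hx1 : wd x1 j L = pr ++ wd x0.1 (-(R:ℤ)) (2*R+1) := by
    refine List.ext_getElem (by simp [wd, hL]) fun r h1 h2 => ?_
    simp only [wd, List.getElem_map, List.getElem_range, x1]
    by_cases hr : r < pr.length
    · rw [if_pos (by omega), List.getElem_append_left hr]
      simp [hr]
    · rw [if_neg (by omega), List.getElem_append_right (by omega)]
      simp only [List.getElem_map, List.getElem_range]
      have hq : j + r = -(R:ℤ) + ((r - pr.length : ℕ) : ℤ) := by omega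
      rw [hq]
  obtain ⟨eh, heb, heY⟩ := exists_code (T := T) j (fun r => phS (x1 (j + r))) L
  have herr : Err T.k0 eh := fun i => ⟨(i - 1 - (j - 1)).natAbs, by
      rw [heb _ (by omega)]; simp⟩
  set E : Set (ℤ → AlSym M N) := {e | ∀ r : ℕ, r < L + 1 → e (j - 1 + r) = (fun r : ℕ => eh (j - 1 + r)) r} with hE
  have hEpos : bern p E ≠ 0 := by
    rw [hE, bern_word p (j-1) (fun r : ℕ => eh (j - 1 + r)) (L+1)]
    exact Finset.prod_ne_zero_iff.2 fun r _ => hp.pos _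
  have hsub : E ∩ T.Good ⊆ T.F ⁻¹' U := by
    rintro e ⟨heE, heG⟩
    apply hR
    have hY : ∀ r < L, Y T.k0 T.W e (j + r) = phS (x1 (j + r)) := by
      intro r hr
      rw [← heY r hr]
      refine Y_congr T.W herr _ _ fun q hq => ?_
      have hage : age T.k0 eh (j + r) ≤ r := by
        apply Nat.sInf_le
        simp only [Set.mem_ofPred_eq]
        rw [heb _ (by omega)]; simp
      have := heE (r + 1 - q) (by omega)
      simp only at this
      rwa [show j - 1 + ((r + 1 - q : ℕ):ℤ) = j + r - q by omega] at this
    have hw : (wd x1 j L).map phS = (wd (T.F e).1 j L).map phS := by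
      simp only [wd, List.map_map]
      refine List.map_congr_left fun r hr => ?_
      simp only [Function.comp]
      rw [phS_F heG, hY r (List.mem_range.1 hr)]
    have hw2 := word_unique _ _ s hw (by rw [hx1]; exact hpr) (SigmaD_wd' (T.F e).2 _ _)
    intro i hi1 hi2
    have := wd_inj hw2 (i - j).toNat (by omega)
    rw [Int.toNat_of_nonneg (by omega), add_sub_cancel] at this
    rw [← this]
    simp only [x1]
    rw [if_neg (by omega)]
  rw [nu_coe, Measure.map_apply F_meas hU.measurableSet]
  refine lt_of_lt_of_le ?_ (measure_mono hsub)
  have : bern p (E ∩ T.Good) = bern p E := measure_inter_conull (by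
    exact good_ae hp)
  rw [this]
  exact pos_iff_ne_zero.2 hEpos

end Tm
end HCP

namespace HCP
namespace Tm
variable {M N : ℕ} {T : Tm M N} {p : Measure (AlSym M N)} [IsProbabilityMeasure p]

/-- Last error before `0` lies in `S`, at time `-1-k`. -/
def lastEv (k0 : Fin M) (S : Set (AlSym M N)) (k : ℕ) : Set (ℤ → AlSym M N) :=
  {e | e (-1 - (k:ℤ)) ∈ S ∧ ∀ r : ℕ, r < k → e (-1 - (r:ℤ)) = .la k0}

/-- The embedding `r ↦ -1 - r`. -/
def negEmb : ℕ ↪ ℤ := ⟨fun r => -1 - (r:ℤ), fun a b h => by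
  have h1 : -1 - (a:ℤ) = -1 - (b:ℤ) := h
  omega⟩

lemma negEmb_apply (r : ℕ) : negEmb r = -1 - (r:ℤ) := rfl

lemma lastEv_eq (k0 : Fin M) (S : Set (AlSym M N)) (k : ℕ) : lastEv k0 S k =
    Set.pi ((Finset.range (k+1)).map negEmb : Finset ℤ)
      (fun j => if j = -1 - (k:ℤ) then S else {AlSym.la k0}) := by
  ext e
  simp only [lastEv, Set.mem_ofPred_eq, Set.mem_pi, Finset.coe_map, Set.mem_image, Finset.coe_range,
    Set.mem_Iio, negEmb_apply]
  constructor
  · rintro ⟨h1, h2⟩ j ⟨r, hr, rfl⟩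
    rcases Nat.lt_succ_iff_lt_or_eq.1 hr with hr | rfl
    · rw [if_neg (by omega)]; exact h2 r hr
    · rw [if_pos rfl]; exact h1
  · intro h
    refine ⟨by have := h (-1 - (k:ℤ)) ⟨k, by omega, rfl⟩; rwa [if_pos rfl] at this, fun r hr => ?_⟩
    have := h (-1 - (r:ℤ)) ⟨r, by omega, rfl⟩
    rwa [if_neg (by omega)] at this

lemma lastEv_meas (k0 : Fin M) (S : Set (AlSym M N)) (k : ℕ) : MeasurableSet (lastEv k0 S k) := by
  rw [lastEv_eq]
  exact MeasurableSet.pi (Finset.countable_toSet _) fun _ _ => MeasurableSet.of_discrete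

lemma lastEv_prob (k0 : Fin M) (S : Set (AlSym M N)) (k : ℕ) :
    bern p (lastEv k0 S k) = p S * p {AlSym.la k0} ^ k := by
  rw [lastEv_eq, bern, Measure.infinitePi_pi _ (fun _ _ => MeasurableSet.of_discrete), Finset.prod_map,
    Finset.prod_range_succ]
  rw [if_pos (negEmb_apply k), mul_comm]
  congr 1
  rw [Finset.prod_congr rfl (g := fun _ => p {AlSym.la k0}), Finset.prod_const, Finset.card_range]
  intro r hr
  have := Finset.mem_range.1 hr
  rw [if_neg (by rw [negEmb_apply]; omega)]

lemma lastU_le (k0 : Fin M) (S : Set (AlSym M N)) :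
    bern p (⋃ k, lastEv k0 S k) ≤ p S * (p {AlSym.la k0}ᶜ)⁻¹ := by
  refine (measure_iUnion_le _).trans ?_
  simp only [lastEv_prob]
  rw [ENNReal.tsum_mul_left, ENNReal.tsum_geometric, prob_compl_eq_one_sub MeasurableSet.of_discrete]

lemma mode_prob (hp : T.Adm p) : ∃ B : Set (ℤ → AlSym M N), MeasurableSet B ∧
    (∀ e, Err T.k0 e → (mode T.k0 e 0 = true ↔ e ∈ B)) ∧
    (bern p).real B = p.real {AlSym.b} / p.real {AlSym.la T.k0}ᶜ := by
  have hm1 : ∀ e : ℤ → AlSym M N, Err T.k0 e → (mode T.k0 e 0 = true ↔ e ∈ ⋃ k, lastEv T.k0 {AlSym.b} k) := by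
    intro e he
    simp only [Set.mem_iUnion]
    constructor
    · intro h
      refine ⟨age T.k0 e 0, ?_, fun r hr => ?_⟩
      · simpa [mode] using h
      · simpa using age_min 0 r hr
    · rintro ⟨k, h1, h2⟩
      have h1' : e (-1 - (k:ℤ)) = .b := h1
      have : age T.k0 e 0 = k := age_eq 0 k (by simp [h1']) (fun r hr => by simpa using h2 r hr)
      simp [mode, this, h1']
  set B1 := ⋃ k, lastEv T.k0 {AlSym.b} k with hB1
  set S2 : Set (AlSym M N) := {AlSym.la T.k0}ᶜ \ {AlSym.b} with hS2
  set B2 := ⋃ k, lastEv T.k0 S2 k with hB2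
  have hBm : MeasurableSet B1 := MeasurableSet.iUnion fun k => lastEv_meas _ _ _
  refine ⟨B1, hBm, hm1, ?_⟩
  have h2 : ∀ e : ℤ → AlSym M N, Err T.k0 e → e ∈ B1ᶜ → e ∈ B2 := by
    intro e he h
    have : mode T.k0 e 0 ≠ true := fun h' => h ((hm1 e he).1 h')
    refine Set.mem_iUnion.2 ⟨age T.k0 e 0, ⟨?_, ?_⟩, fun r hr => ?_⟩
    · simpa using age_spec he 0
    · simpa [mode] using this
    · simpa using age_min 0 r hr
  have hle1 : bern p B1 ≤ p {AlSym.b} * (p {AlSym.la T.k0}ᶜ)⁻¹ := lastU_le _ _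
  have hle2 : bern p B1ᶜ ≤ p S2 * (p {AlSym.la T.k0}ᶜ)⁻¹ := by
    refine le_trans (measure_mono_ae ?_) (lastU_le T.k0 S2)
    filter_upwards [good_ae hp] with e he
    exact h2 e (Good.err he)
  have hη : p {AlSym.la T.k0}ᶜ ≠ 0 := fun h =>
    hp.pos .b (measure_mono_null (by simp) h)
  have hη' : 0 < p.real {AlSym.la T.k0}ᶜ := ENNReal.toReal_pos hη (measure_ne_top _ _)
  have hfin : (p {AlSym.la T.k0}ᶜ)⁻¹ ≠ ⊤ := ENNReal.inv_ne_top.2 hη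
  have r1 : (bern p).real B1 ≤ p.real {AlSym.b} / p.real {AlSym.la T.k0}ᶜ := by
    have := ENNReal.toReal_mono (ENNReal.mul_ne_top (measure_ne_top _ _) hfin) hle1
    rwa [ENNReal.toReal_mul, ENNReal.toReal_inv] at this
  have r2 : (bern p).real B1ᶜ ≤ p.real S2 / p.real {AlSym.la T.k0}ᶜ := by
    have := ENNReal.toReal_mono (ENNReal.mul_ne_top (measure_ne_top _ _) hfin) hle2
    rwa [ENNReal.toReal_mul, ENNReal.toReal_inv] at this
  have r3 : (bern p).real B1ᶜ = 1 - (bern p).real B1 := probReal_compl_eq_one_sub hBm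
  have r4 : p.real S2 = p.real {AlSym.la T.k0}ᶜ - p.real {AlSym.b} :=
    measureReal_sdiff (by simp) MeasurableSet.of_discrete
  rw [r3, r4, sub_div, div_self hη'.ne'] at r2
  linarith

end Tm
end HCP

namespace HCP

lemma per_sum (g : ℕ → ℝ) (n : ℕ) (hg : ∀ k, g (k + n) = g k) (q : ℕ) :
    ∑ i ∈ Finset.range n, g (q + i) = ∑ i ∈ Finset.range n, g i := by
  induction q with
  | zero => simp
  | succ q ih =>
    rw [← ih]
    have h1 := Finset.sum_range_succ (fun i => g (q + i)) n
    have h2 := Finset.sum_range_succ' (fun i => g (q + i)) n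
    rw [h1] at h2
    rw [hg] at h2
    simp only [add_zero] at h2
    have h3 : ∀ i, g (q + 1 + i) = g (q + (i + 1)) := fun i => by congr 1; ring
    simp only [h3]
    linarith

lemma shiftD_iter {M N : ℕ} (x : ↥(SigmaD M N)) (k : ℕ) (i : ℤ) :
    ((shiftD M N)^[k] x).val i = x.val (i + k) := by
  induction k generalizing x with
  | zero => simp
  | succ k ih =>
    rw [Function.iterate_succ_apply, ih]
    simp only [shiftD, shift]
    push_cast
    exact congrArg x.val (by ring)

namespace Tm
variable {M N : ℕ} (T : Tm M N)

/-- The points on the template orbits. -/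
def pt (m : Bool) (k : ℕ) : ↥(SigmaD M N) := (shiftD M N)^[k] ⟨T.xh m, T.mem m⟩

lemma pt_val (m : Bool) (k : ℕ) (i : ℤ) : (T.pt m k).val i = T.xh m (i + k) := by
  rw [pt, shiftD_iter]

lemma pt_per (m : Bool) (k : ℕ) : T.pt m (k + T.n) = T.pt m k := by
  apply Subtype.ext; funext i
  rw [pt_val, pt_val]; push_cast
  rw [← add_assoc, T.per]

lemma pt_mod (m : Bool) (k : ℕ) : T.pt m k = T.pt m (k % T.n) := by
  have h : ∀ j q : ℕ, T.pt m (q + T.n * j) = T.pt m q := by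
    intro j q
    induction j with
    | zero => simp
    | succ j ih => rw [Nat.mul_succ, ← add_assoc, pt_per, ih]
  conv_lhs => rw [← Nat.mod_add_div k T.n]
  exact h _ _

/-- Orbit average along a template. -/
noncomputable def orb (f : ↥(SigmaD M N) → ℝ) (m : Bool) : ℝ :=
  (∑ k ∈ Finset.range T.n, f (T.pt m k)) / T.n

lemma unif_window (f : ↥(SigmaD M N) → ℝ) (hf : Continuous f) (δ : ℝ) (hδ : 0 < δ) :
    ∃ R : ℕ, ∀ m q, ∀ x : ↥(SigmaD M N),
      (∀ i : ℤ, -(R:ℤ) ≤ i → i ≤ R → x.val i = (T.pt m q).val i) → |f x - f (T.pt m q)| ≤ δ := by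
  have h : ∀ m k, ∃ R : ℕ, ∀ x : ↥(SigmaD M N),
      (∀ i : ℤ, -(R:ℤ) ≤ i → i ≤ R → x.val i = (T.pt m k).val i) →
        x ∈ {x | |f x - f (T.pt m k)| < δ} := by
    intro m k
    refine exists_window _ ?_ _ (by simpa using hδ)
    exact isOpen_lt (by fun_prop) continuous_const
  choose R hR using h
  refine ⟨(Finset.range T.n).sup (fun k => max (R true k) (R false k)), fun m q x hx => ?_⟩
  rw [T.pt_mod m q] at *
  have hq : q % T.n ∈ Finset.range T.n := Finset.mem_range.2 (Nat.mod_lt _ T.hn)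
  have h1 := Finset.le_sup (f := fun k => max (R true k) (R false k)) hq
  have h2 : R m (q % T.n) ≤ max (R true (q % T.n)) (R false (q % T.n)) := by
    cases m <;> simp
  have h3 := h2.trans h1
  refine (hR m (q % T.n) x fun i hi hi' => hx i ?_ ?_).le
  · zify at h3; linarith
  · zify at h3; linarith

variable {T} {p : Measure (AlSym M N)} [IsProbabilityMeasure p]

lemma avg_close (f : ↥(SigmaD M N) → ℝ) (δ : ℝ) (R : ℕ)
    (hR : ∀ m q, ∀ x : ↥(SigmaD M N),
      (∀ i : ℤ, -(R:ℤ) ≤ i → i ≤ R → x.val i = (T.pt m q).val i) → |f x - f (T.pt m q)| ≤ δ)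
    {e} (he : e ∈ T.Good) (hz : ∀ r : ℕ, r < 2 * R + T.n + 1 → e r = .la T.k0) :
    |(∑ i ∈ Finset.range T.n, f ((shiftD M N)^[i + R] (T.F e))) / T.n - T.orb f (mode T.k0 e 0)| ≤ δ := by
  have hn : (0:ℝ) < T.n := by exact_mod_cast T.hn
  set m := mode T.k0 e 0 with hm
  set A := age T.k0 e 0 with hA
  have hfol := follow (Good.err he) T.xh T.mem T.hH (T.F e).val (T.F e).2 (phS_F he) 0 (2 * R + T.n + 1)
    (fun r hr => by rw [zero_add]; exact hz r hr)
  have hstep : ∀ i ∈ Finset.range T.n,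
      |f ((shiftD M N)^[i + R] (T.F e)) - f (T.pt m (A + R + i))| ≤ δ := by
    intro i hi
    have hi := Finset.mem_range.1 hi
    apply hR
    intro j hj hj'
    rw [shiftD_iter, pt_val]
    have := hfol (j + i + R).toNat (by omega)
    rw [zero_add, Int.toNat_of_nonneg (by omega)] at this
    rw [show j + ((i + R : ℕ) : ℤ) = j + i + R by push_cast; ring, this]
    congr 1
    push_cast
    omega
  have hs : T.orb f m = (∑ i ∈ Finset.range T.n, f (T.pt m (A + R + i))) / T.n := by
    rw [orb, per_sum (fun k => f (T.pt m k)) T.n (fun k => by rw [pt_per])]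
  rw [hs, ← sub_div, ← Finset.sum_sub_distrib, abs_div, abs_of_pos hn, div_le_iff₀ hn]
  refine (Finset.abs_sum_le_sum_abs _ _).trans ((Finset.sum_le_sum hstep).trans ?_)
  simp [mul_comm]

lemma orb_le (f : BoundedContinuousFunction ↥(SigmaD M N) ℝ) (m : Bool) : |T.orb f m| ≤ ‖f‖ := by
  have hn : (0:ℝ) < T.n := by exact_mod_cast T.hn
  rw [orb, abs_div, abs_of_pos hn, div_le_iff₀ hn]
  refine (Finset.abs_sum_le_sum_abs _ _).trans
    ((Finset.sum_le_sum (fun i _ => f.norm_coe_le_norm _)).trans ?_)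
  simp [mul_comm]

lemma bad_prob (L : ℕ) : (bern p).real {e | ∃ r : ℕ, r < L ∧ e r ≠ .la T.k0} ≤
    L * p.real {AlSym.la T.k0}ᶜ := by
  have hset : {e : ℤ → AlSym M N | ∃ r : ℕ, r < L ∧ e r ≠ .la T.k0} =
      ⋃ r ∈ Finset.range L, (fun e : ℤ → AlSym M N => e r) ⁻¹' {AlSym.la T.k0}ᶜ := by
    ext e; simp
  rw [hset]
  refine (measureReal_biUnion_finset_le _ _).trans ?_
  rw [Finset.sum_congr rfl (g := fun _ => p.real {AlSym.la T.k0}ᶜ)]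
  · simp
  · intro r _
    have : (bern p).map (fun e : ℤ → AlSym M N => e r) = p := Measure.infinitePi_map_eval _ _
    rw [measureReal_def, ← Measure.map_apply (measurable_pi_apply _) MeasurableSet.of_discrete, this]
    rfl

lemma close (f : BoundedContinuousFunction ↥(SigmaD M N) ℝ) (δ : ℝ) (hδ : 0 < δ) :
    ∃ C : ℝ, ∀ (p : Measure (AlSym M N)) [IsProbabilityMeasure p], T.Adm p →
      |∫ x, f x ∂(T.nu p).toMeasure - (T.orb f false +
        p.real {AlSym.b} / p.real {AlSym.la T.k0}ᶜ * (T.orb f true - T.orb f false))| ≤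
      δ + C * p.real {AlSym.la T.k0}ᶜ := by
  obtain ⟨R, hR⟩ := T.unif_window f f.continuous δ hδ
  set L := 2 * R + T.n + 1 with hL
  refine ⟨4 * ‖f‖ * L, fun p _ hp => ?_⟩
  have hn : (0:ℝ) < T.n := by exact_mod_cast T.hn
  obtain ⟨B, hB, hBm, hBp⟩ := mode_prob hp
  set Bad : Set (ℤ → AlSym M N) := {e | ∃ r : ℕ, r < L ∧ e r ≠ .la T.k0} with hBad
  have hBadm : MeasurableSet Bad := by
    have hset : Bad = ⋃ r ∈ Finset.range L, (fun e : ℤ → AlSym M N => e r) ⁻¹' {AlSym.la T.k0}ᶜ := by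
      ext e; simp [hBad]
    rw [hset]
    exact Finset.measurableSet_biUnion _ fun r _ => measurable_pi_apply _ MeasurableSet.of_discrete
  set g : (ℤ → AlSym M N) → ℝ := fun e =>
    (∑ i ∈ Finset.range T.n, f ((shiftD M N)^[i + R] (T.F e))) / T.n with hg
  set h : (ℤ → AlSym M N) → ℝ := fun e =>
    T.orb f false + B.indicator (fun _ => T.orb f true - T.orb f false) e with hh
  have hfi : ∀ k : ℕ, Integrable (fun e => f ((shiftD M N)^[k] (T.F e))) (bern p) := by
    intro k
    refine Integrable.of_bound ?_ ‖f‖ (ae_of_all _ fun e => f.norm_coe_le_norm _)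
    exact (f.continuous.measurable.comp ((cont_shiftD.measurable.iterate k).comp F_meas)).aestronglyMeasurable
  have hgi : Integrable g (bern p) := (integrable_finsetSum _ fun i _ => hfi _).div_const _
  have hhi : Integrable h (bern p) :=
    (integrable_const _).add ((integrable_const _).indicator hB)
  have hgint : ∫ e, g e ∂(bern p) = ∫ x, f x ∂(T.nu p).toMeasure := by
    have h1 : ∀ k : ℕ, ∫ e, f ((shiftD M N)^[k] (T.F e)) ∂(bern p) = ∫ x, f x ∂(T.nu p).toMeasure := by
      intro k
      have h2 := ((nu_mp hp).iterate k).map_eq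
      conv_rhs => rw [← h2]
      rw [integral_map (cont_shiftD.measurable.iterate k).aemeasurable
        f.continuous.measurable.aestronglyMeasurable, nu_coe, integral_map F_meas.aemeasurable]
      exact (f.continuous.measurable.comp (cont_shiftD.measurable.iterate k)).aestronglyMeasurable
    simp only [hg]
    rw [integral_div, integral_finsetSum _ fun i _ => hfi _]
    simp only [h1]
    simp
    field_simp
  have hhint : ∫ e, h e ∂(bern p) = T.orb f false +
        p.real {AlSym.b} / p.real {AlSym.la T.k0}ᶜ * (T.orb f true - T.orb f false) := by
    simp only [hh]
    rw [integral_add (integrable_const _) ((integrable_const _).indicator hB),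
      integral_indicator_const _ hB, hBp]
    simp
  rw [← hgint, ← hhint, ← integral_sub hgi hhi]
  have hpt : ∀ᵐ e ∂(bern p), ‖g e - h e‖ ≤ δ + Bad.indicator (fun _ => 4 * ‖f‖) e := by
    filter_upwards [good_ae hp] with e he
    have hhe : h e = T.orb f (mode T.k0 e 0) := by
      simp only [hh]
      by_cases hb : e ∈ B
      · rw [Set.indicator_of_mem hb, (hBm e (Good.err he)).2 hb]; ring
      · rw [Set.indicator_of_notMem hb]
        have : mode T.k0 e 0 = false := by
          by_contra hc
          exact hb ((hBm e (Good.err he)).1 (by simpa using hc))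
        rw [this, add_zero]
    rw [hhe, Real.norm_eq_abs]
    by_cases hbad : e ∈ Bad
    · rw [Set.indicator_of_mem hbad]
      have h1 : |g e| ≤ ‖f‖ := by
        simp only [hg]
        rw [abs_div, abs_of_pos hn, div_le_iff₀ hn]
        refine (Finset.abs_sum_le_sum_abs _ _).trans
          ((Finset.sum_le_sum (fun i _ => f.norm_coe_le_norm _)).trans ?_)
        simp [mul_comm]
      have h2 := orb_le (T := T) f (mode T.k0 e 0)
      have h3 := abs_sub (g e) (T.orb f (mode T.k0 e 0))
      have := norm_nonneg f
      linarith
    · rw [Set.indicator_of_notMem hbad, add_zero]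
      refine avg_close f δ R hR he fun r hr => ?_
      by_contra hc
      exact hbad ⟨r, hr, hc⟩
  have hbi : Integrable (fun e => δ + Bad.indicator (fun _ => 4 * ‖f‖) e) (bern p) :=
    (integrable_const _).add ((integrable_const _).indicator hBadm)
  have := norm_integral_le_of_norm_le hbi hpt
  rw [Real.norm_eq_abs] at this
  refine this.trans ?_
  rw [integral_add (integrable_const _) ((integrable_const _).indicator hBadm),
      integral_indicator_const _ hBadm]
  have hb := bad_prob (T := T) (p := p) L
  have hf0 := norm_nonneg f
  simp only [integral_const, probReal_univ, smul_eq_mul]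
  have := mul_le_mul_of_nonneg_right hb (by positivity : 0 ≤ 4 * ‖f‖)
  nlinarith

end Tm
end HCP

namespace HCP
namespace Tm
variable {M N : ℕ} {T : Tm M N}

lemma conv (p : ℕ → ProbabilityMeasure (AlSym M N)) (hp : ∀ k, T.Adm (p k).toMeasure) (τ : ℝ)
    (hη : Tendsto (fun k => (p k).toMeasure.real {AlSym.la T.k0}ᶜ) atTop (𝓝 0))
    (hτ : Tendsto (fun k => (p k).toMeasure.real {AlSym.b} / (p k).toMeasure.real {AlSym.la T.k0}ᶜ)
      atTop (𝓝 τ))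
    (ρ : ProbabilityMeasure ↥(SigmaD M N))
    (hρ : ∀ f : BoundedContinuousFunction ↥(SigmaD M N) ℝ, ∫ x, f x ∂ρ.toMeasure =
      T.orb f false + τ * (T.orb f true - T.orb f false)) :
    Tendsto (fun k => T.nu (p k).toMeasure) atTop (𝓝 ρ) := by
  rw [ProbabilityMeasure.tendsto_iff_forall_integral_tendsto]
  intro f
  rw [hρ f]
  have h1 : Tendsto (fun k => T.orb f false + (p k).toMeasure.real {AlSym.b} /
      (p k).toMeasure.real {AlSym.la T.k0}ᶜ * (T.orb f true - T.orb f false)) atTop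
      (𝓝 (T.orb f false + τ * (T.orb f true - T.orb f false))) :=
    tendsto_const_nhds.add (hτ.mul_const _)
  rw [← sub_zero (T.orb f false + τ * (T.orb f true - T.orb f false))]
  have h2 : Tendsto (fun k => T.orb f false + (p k).toMeasure.real {AlSym.b} /
      (p k).toMeasure.real {AlSym.la T.k0}ᶜ * (T.orb f true - T.orb f false) -
      ∫ x, f x ∂(T.nu (p k).toMeasure).toMeasure) atTop (𝓝 0) := by
    rw [Metric.tendsto_atTop]
    intro ε hε
    obtain ⟨C, hC⟩ := close (T := T) f (ε / 2) (by positivity)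
    have h3 : Tendsto (fun k => ε / 2 + C * (p k).toMeasure.real {AlSym.la T.k0}ᶜ) atTop
        (𝓝 (ε / 2 + C * 0)) := tendsto_const_nhds.add (hη.const_mul C)
    have h4 := h3.eventually_lt_const (u := ε) (by linarith)
    obtain ⟨n0, hn0⟩ := eventually_atTop.1 h4
    refine ⟨n0, fun k hk => ?_⟩
    rw [Real.dist_eq, sub_zero, abs_sub_comm]
    exact (hC (p k).toMeasure (hp k)).trans_lt (hn0 k hk)
  exact (h1.sub h2).congr fun k => by ring

variable (T) in
/-- The auxiliary symbols. -/
abbrev O : Type := {o : AlSym M N // o ≠ .la T.k0 ∧ o ≠ .b}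

/-- Uniform law on `[0,1)`. -/
noncomputable def lam : Measure ℝ := volume.restrict (Set.Ico 0 1)

instance : IsProbabilityMeasure lam := ⟨by simp [lam]⟩

variable (T) in
/-- The site map. -/
noncomputable def st (a c : ℝ) (w : ℝ × T.O) : AlSym M N :=
  if w.1 < a then .b else if w.1 < a + c then w.2.1 else .la T.k0

lemma st_meas (a c : ℝ) : Measurable (T.st a c) := by
  unfold st
  refine Measurable.ite (measurableSet_lt measurable_fst measurable_const) measurable_const
    (Measurable.ite (measurableSet_lt measurable_fst measurable_const) ?_ measurable_const)
  exact measurable_subtype_coe.comp measurable_snd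

variable (ρ : Measure T.O) [IsProbabilityMeasure ρ]

/-- The site law. -/
noncomputable def law (a c : ℝ) : ProbabilityMeasure (AlSym M N) :=
  ⟨(lam.prod ρ).map (T.st a c), Measure.isProbabilityMeasure_map (st_meas a c).aemeasurable⟩

lemma lam_Iio (a : ℝ) (h1 : a ≤ 1) : lam (Set.Iio a) = ENNReal.ofReal a := by
  rw [lam, Measure.restrict_apply measurableSet_Iio,
    show Set.Iio a ∩ Set.Ico 0 1 = Set.Ico 0 a by
      ext x; simp only [Set.mem_inter_iff, Set.mem_Iio, Set.mem_Ico]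
      constructor
      · rintro ⟨h, h', h''⟩; exact ⟨h', h⟩
      · rintro ⟨h, h'⟩; exact ⟨h', h, by linarith⟩]
  simp

lemma lam_Ico (a b : ℝ) (h0 : 0 ≤ a) (h1 : b ≤ 1) : lam (Set.Ico a b) = ENNReal.ofReal (b - a) := by
  rw [lam, Measure.restrict_apply measurableSet_Ico,
    show Set.Ico a b ∩ Set.Ico 0 1 = Set.Ico a b by
      ext x; simp only [Set.mem_inter_iff, Set.mem_Ico]
      constructor
      · rintro ⟨⟨h, h'⟩, h''⟩; exact ⟨h, h'⟩
      · rintro ⟨h, h'⟩; exact ⟨⟨h, h'⟩, by linarith, by linarith⟩]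
  simp

variable {a c : ℝ}

lemma law_apply (S : Set (AlSym M N)) : (law ρ a c).toMeasure S = (lam.prod ρ) (T.st a c ⁻¹' S) :=
  Measure.map_apply (st_meas a c) MeasurableSet.of_discrete

lemma law_b (ha : 0 < a) (hc : 0 < c) (h1 : a + c < 1) : (law ρ a c).toMeasure.real {AlSym.b} = a := by
  rw [measureReal_def, law_apply]
  have : T.st a c ⁻¹' {AlSym.b} = Set.Iio a ×ˢ Set.univ := by
    ext ⟨u, o⟩
    simp only [st, Set.mem_preimage, Set.mem_singleton_iff, Set.mem_prod, Set.mem_Iio, Set.mem_univ,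
      and_true]
    split_ifs with h h'
    · simp [h]
    · simp [h, o.2.2]
    · simp [h]
  rw [this, Measure.prod_prod, lam_Iio a (by linarith)]
  simp [ha.le]

lemma law_z (ha : 0 < a) (hc : 0 < c) (h1 : a + c < 1) :
    (law ρ a c).toMeasure.real {AlSym.la T.k0}ᶜ = a + c := by
  rw [measureReal_def, law_apply]
  have : T.st a c ⁻¹' {AlSym.la T.k0}ᶜ = Set.Iio (a + c) ×ˢ Set.univ := by
    ext ⟨u, o⟩
    simp only [st, Set.mem_preimage, Set.mem_compl_iff, Set.mem_singleton_iff, Set.mem_prod,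
      Set.mem_Iio, Set.mem_univ, and_true]
    split_ifs with h h'
    · have : u < a + c := by linarith
      simp [this]
    · simp [h', o.2.1]
    · simp [h']
  rw [this, Measure.prod_prod, lam_Iio (a + c) h1.le]
  simp; linarith

lemma law_adm (hρ : ∀ o, ρ {o} ≠ 0) (ha : 0 < a) (hc : 0 < c) (h1 : a + c < 1)
    (hK : (T.K : ℝ) * (a + c) < 1) : T.Adm (law ρ a c).toMeasure := by
  refine ⟨fun s => ?_, by rwa [law_z ρ ha hc h1]⟩
  by_cases hs : s = .b
  · subst hs
    intro h
    have := law_b ρ ha hc h1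
    rw [measureReal_def, h] at this
    simp at this; linarith
  by_cases hs' : s = .la T.k0
  · subst hs'
    intro h
    have h2 := law_z ρ ha hc h1
    rw [probReal_compl_eq_one_sub MeasurableSet.of_discrete, measureReal_def, h] at h2
    simp at h2; linarith
  rw [law_apply]
  have hsub : Set.Ico a (a + c) ×ˢ {(⟨s, hs', hs⟩ : T.O)} ⊆ T.st a c ⁻¹' {s} := by
    rintro ⟨u, o⟩ ⟨⟨h, h'⟩, h''⟩
    have h'' : o = ⟨s, hs', hs⟩ := h''
    have h : a ≤ u := h
    have h' : u < a + c := h'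
    simp only [st, Set.mem_preimage, Set.mem_singleton_iff]
    rw [if_neg (by linarith), if_pos h', h'']
  intro h
  have h2 := measure_mono_null hsub h
  rw [Measure.prod_prod, lam_Ico _ _ ha.le h1.le] at h2
  simp only [mul_eq_zero, hρ, or_false, ENNReal.ofReal_eq_zero] at h2
  linarith

lemma bern_law : bern (law ρ a c).toMeasure =
    (bern (lam.prod ρ)).map (fun ω i => T.st a c (ω i)) :=
  (Measure.infinitePi_map_pi (fun _ : ℤ => lam.prod ρ) (fun _ : ℤ => st_meas a c)).symm

lemma bern_law_ae (P : (ℤ → AlSym M N) → Prop) (h : ∀ᵐ e ∂(bern (law ρ a c).toMeasure), P e) :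
    ∀ᵐ ω ∂(bern (lam.prod ρ)), P (fun i => T.st a c (ω i)) := by
  rw [bern_law] at h
  exact ae_of_ae_map (measurable_pi_iff.2 fun i =>
    (st_meas a c).comp (measurable_pi_apply i)).aemeasurable h

lemma st_evt (ak ck : ℕ → ℝ) (ha : Tendsto ak atTop (𝓝 a)) (hc : Tendsto ck atTop (𝓝 c))
    (w : ℝ × T.O) (h1 : w.1 ≠ a) (h2 : w.1 ≠ a + c) :
    ∀ᶠ k in atTop, T.st (ak k) (ck k) w = T.st a c w := by
  have key : ∀ (b : ℝ) (bk : ℕ → ℝ), Tendsto bk atTop (𝓝 b) → w.1 ≠ b →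
      ∀ᶠ k in atTop, (w.1 < bk k ↔ w.1 < b) := by
    intro b bk hb hne
    rcases lt_or_gt_of_ne hne with h | h
    · filter_upwards [hb.eventually_const_lt h] with k hk
      simp [hk, h]
    · filter_upwards [hb.eventually_lt_const h] with k hk
      constructor <;> intro <;> linarith
  filter_upwards [key a ak ha h1, key (a + c) _ (ha.add hc) h2] with k hk1 hk2
  simp only [st, hk1, hk2]

lemma ne_ae (b : ℝ) : ∀ᵐ ω ∂(bern (lam.prod ρ)), ∀ i : ℤ, (ω i).1 ≠ b := by
  rw [ae_all_iff]
  intro i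
  have h1 : (bern (lam.prod ρ)).map (fun ω : ℤ → ℝ × T.O => ω i) = lam.prod ρ :=
    Measure.infinitePi_map_eval _ _
  have h2 : ∀ᵐ w ∂(lam.prod ρ), w.1 ≠ b := by
    have h3 : ∀ᵐ u ∂lam, u ≠ b := by
      rw [lam]
      exact ae_restrict_of_ae (by simp [ae_iff])
    exact Measure.quasiMeasurePreserving_fst.ae h3
  rw [← h1] at h2
  exact ae_of_ae_map (measurable_pi_apply i).aemeasurable h2

lemma law_cont (ak ck : ℕ → ℝ) (ha : Tendsto ak atTop (𝓝 a)) (hc : Tendsto ck atTop (𝓝 c))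
    (hk : ∀ k, T.Adm (law ρ (ak k) (ck k)).toMeasure) (hp : T.Adm (law ρ a c).toMeasure) :
    Tendsto (fun k => T.nu (law ρ (ak k) (ck k)).toMeasure) atTop
      (𝓝 (T.nu (law ρ a c).toMeasure)) := by
  rw [ProbabilityMeasure.tendsto_iff_forall_integral_tendsto]
  intro f
  have hS : ∀ a c, Measurable (fun (ω : ℤ → ℝ × T.O) i => T.st a c (ω i)) := fun a c =>
    measurable_pi_iff.2 fun i => (st_meas a c).comp (measurable_pi_apply i)
  have hinn : ∀ a c, ∫ x, f x ∂(T.nu (law ρ a c).toMeasure).toMeasure =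
      ∫ ω, f (T.F (fun i => T.st a c (ω i))) ∂(bern (lam.prod ρ)) := by
    intro a c
    rw [nu_coe, integral_map F_meas.aemeasurable f.continuous.measurable.aestronglyMeasurable,
      bern_law, integral_map (hS a c).aemeasurable]
    exact (f.continuous.measurable.comp F_meas).aestronglyMeasurable
  simp only [hinn]
  refine tendsto_integral_of_dominated_convergence (fun _ => ‖f‖) ?_ (integrable_const _)
    (fun k => ae_of_all _ fun ω => f.norm_coe_le_norm _) ?_
  · intro k
    exact (f.continuous.measurable.comp (F_meas.comp (hS _ _))).aestronglyMeasurable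
  · have hg : ∀ᵐ ω ∂(bern (lam.prod ρ)), ∀ k, (fun i => T.st (ak k) (ck k) (ω i)) ∈ T.Good :=
      ae_all_iff.2 fun k => bern_law_ae ρ (· ∈ T.Good) (good_ae (hk k))
    filter_upwards [hg, bern_law_ae ρ (· ∈ T.Good) (good_ae hp), ne_ae ρ a, ne_ae ρ (a + c)]
      with ω h1 h2 h3 h4
    refine (f.continuous.tendsto _).comp ?_
    refine (F_cont _ h2).tendsto.comp ?_
    rw [tendsto_nhdsWithin_iff]
    refine ⟨?_, Eventually.of_forall h1⟩
    rw [tendsto_pi_nhds]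
    intro i
    exact tendsto_nhds_of_eventually_eq (st_evt ak ck ha hc (ω i) (h3 i) (h4 i))

end Tm
end HCP

namespace HCP
variable {M N : ℕ}

lemma iter_per {x : ↥(SigmaD M N)} {n : ℕ} (hx : (shiftD M N)^[n] x = x) (k : ℕ) :
    (shiftD M N)^[k + n] x = (shiftD M N)^[k] x := by
  rw [Function.iterate_add_apply, hx]

lemma co_int {μ : ProbabilityMeasure ↥(SigmaD M N)}
    (hinv : MeasurePreserving (shiftD M N) μ.toMeasure μ.toMeasure) {x : ↥(SigmaD M N)} {n : ℕ}
    (hn : 0 < n) (hx : (shiftD M N)^[n] x = x)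
    (horb : μ.toMeasure {y | ∃ k : ℕ, y = (shiftD M N)^[k] x} = 1)
    (f : ↥(SigmaD M N) → ℝ) (hf : Measurable f) (C : ℝ) (hC : ∀ y, ‖f y‖ ≤ C) :
    ∫ y, f y ∂μ.toMeasure = (∑ k ∈ Finset.range n, f ((shiftD M N)^[k] x)) / n := by
  have hn' : (0:ℝ) < n := by exact_mod_cast hn
  have hmeas : MeasurableSet {y | ∃ k : ℕ, y = (shiftD M N)^[k] x} := by
    apply Set.Countable.measurableSet
    have : {y | ∃ k : ℕ, y = (shiftD M N)^[k] x} = Set.range fun k : ℕ => (shiftD M N)^[k] x := by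
      ext y; simp [eq_comm]
    rw [this]; exact Set.countable_range _
  have hae : ∀ᵐ y ∂μ.toMeasure, ∃ k : ℕ, y = (shiftD M N)^[k] x :=
    (mem_ae_iff_prob_eq_one hmeas).2 horb
  have hsm : ∀ k, Measurable ((shiftD M N)^[k]) := fun k => Tm.cont_shiftD.measurable.iterate k
  have hfi : ∀ k : ℕ, Integrable (fun y => f ((shiftD M N)^[k] y)) μ.toMeasure := fun k =>
    Integrable.of_bound (hf.comp (hsm k)).aestronglyMeasurable C (ae_of_all _ fun e => hC _)
  have h1 : ∀ k : ℕ, ∫ y, f ((shiftD M N)^[k] y) ∂μ.toMeasure = ∫ y, f y ∂μ.toMeasure := by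
    intro k
    conv_rhs => rw [← (hinv.iterate k).map_eq]
    rw [integral_map (hsm k).aemeasurable hf.aestronglyMeasurable]
  have h2 : ∫ y, (∑ k ∈ Finset.range n, f ((shiftD M N)^[k] y)) ∂μ.toMeasure =
      n * ∫ y, f y ∂μ.toMeasure := by
    rw [integral_finsetSum _ fun i _ => hfi _]
    simp only [h1]; simp
  have h3 : ∫ y, (∑ k ∈ Finset.range n, f ((shiftD M N)^[k] y)) ∂μ.toMeasure =
      ∑ k ∈ Finset.range n, f ((shiftD M N)^[k] x) := by
    rw [integral_congr_ae (g := fun _ => ∑ k ∈ Finset.range n, f ((shiftD M N)^[k] x))]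
    · simp
    · filter_upwards [hae] with y hy
      obtain ⟨j, rfl⟩ := hy
      rw [← per_sum (fun k => f ((shiftD M N)^[k] x)) n (fun k => by rw [iter_per hx]) j]
      refine Finset.sum_congr rfl fun k _ => ?_
      rw [← Function.iterate_add_apply, add_comm]
  rw [eq_div_iff hn'.ne', ← h3, h2]; ring

lemma Hfun_iter (x : ↥(SigmaD M N)) (j k : ℕ) :
    Hfun ((shiftD M N)^[j] x).val k = Hfun x.val ((j + k : ℕ) : ℤ) - Hfun x.val j := by
  induction k with
  | zero => simp [Hfun_zero]
  | succ k ih =>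
    push_cast at *
    rw [Hfun_succ, ih, shiftD_iter, ← add_assoc, Hfun_succ, add_comm (k:ℤ) j]
    ring

lemma Hfun_sum (x : ↥(SigmaD M N)) (n : ℕ) :
    ∑ k ∈ Finset.range n, EAl (phiAl ((shiftD M N)^[k] x).val) = n + (Hfun x.val n : ℝ) := by
  induction n with
  | zero => simp [Hfun_zero]
  | succ n ih =>
    rw [Finset.sum_range_succ, ih, EAl_eq, shiftD_iter]
    push_cast
    rw [Hfun_succ]; push_cast; rw [zero_add]; ring

lemma E_meas : Measurable (fun x : ↥(SigmaD M N) => EAl (phiAl x.val)) := by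
  simp only [EAl_eq]
  exact (measurable_of_countable (fun a : DMSym M N => 1 + (gS (phS a) : ℝ))).comp
    ((measurable_pi_apply 0).comp measurable_subtype_coe)

lemma E_bdd (x : ↥(SigmaD M N)) : ‖EAl (phiAl x.val)‖ ≤ 2 := by
  rw [Real.norm_eq_abs]
  unfold EAl
  split <;> norm_num

lemma co_rot {μ : ProbabilityMeasure ↥(SigmaD M N)}
    (hinv : MeasurePreserving (shiftD M N) μ.toMeasure μ.toMeasure) {x : ↥(SigmaD M N)} {n : ℕ}
    (hn : 0 < n) (hx : (shiftD M N)^[n] x = x)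
    (horb : μ.toMeasure {y | ∃ k : ℕ, y = (shiftD M N)^[k] x} = 1)
    (hE : 1 < ∫ x, EAl (phiAl x.val) ∂μ.toMeasure) :
    ∃ y : ↥(SigmaD M N), (∀ i, y.val (i + n) = y.val i) ∧ (∀ k : ℕ, 0 ≤ Hfun y.val k) ∧
      1 ≤ Hfun y.val n ∧ ∀ f : BoundedContinuousFunction ↥(SigmaD M N) ℝ,
        ∫ y, f y ∂μ.toMeasure = (∑ k ∈ Finset.range n, f ((shiftD M N)^[k] y)) / n := by
  have hn' : (0:ℝ) < n := by exact_mod_cast hn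
  have hHn : 1 ≤ Hfun x.val n := by
    rw [co_int hinv hn hx horb _ E_meas 2 E_bdd, Hfun_sum, lt_div_iff₀ hn'] at hE
    have : (0:ℝ) < Hfun x.val n := by linarith
    exact_mod_cast this
  have hper : ∀ k : ℕ, Hfun x.val ((k + n : ℕ) : ℤ) = Hfun x.val k + Hfun x.val n := by
    intro k
    have := Hfun_iter x n k
    rw [hx, add_comm n k] at this
    linarith
  obtain ⟨j, hj, hmin⟩ := Finset.exists_min_image (Finset.range n) (fun j : ℕ => Hfun x.val j)
    ⟨0, Finset.mem_range.2 hn⟩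
  have hall : ∀ q : ℕ, Hfun x.val j ≤ Hfun x.val q := by
    intro q
    induction q using Nat.strong_induction_on with
    | _ q ih =>
      by_cases hq : q < n
      · exact hmin q (Finset.mem_range.2 hq)
      · have h1 := hper (q - n)
        have h2 := ih (q - n) (by omega)
        rw [Nat.sub_add_cancel (by omega)] at h1
        omega
  refine ⟨(shiftD M N)^[j] x, fun i => ?_, fun k => ?_, ?_, fun f => ?_⟩
  · have : (shiftD M N)^[n] ((shiftD M N)^[j] x) = (shiftD M N)^[j] x := by
      rw [← Function.iterate_add_apply, add_comm, iter_per hx]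
    conv_rhs => rw [← this]
    rw [shiftD_iter _ n]
  · rw [Hfun_iter]
    have := hall (j + k)
    omega
  · rw [Hfun_iter, hper]; omega
  · rw [co_int hinv hn hx horb f f.continuous.measurable ‖f‖ f.norm_coe_le_norm,
      ← per_sum (fun k => f ((shiftD M N)^[k] x)) n (fun k => by rw [iter_per hx]) j]
    congr 1
    refine Finset.sum_congr rfl fun k _ => ?_
    rw [← Function.iterate_add_apply, add_comm]

lemma exists_Tm (hM : 2 ≤ M) (μ μ' : ProbabilityMeasure ↥(SigmaD M N))
    (hCO : IsCOMeas (shiftD M N) μ) (hCO' : IsCOMeas (shiftD M N) μ')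
    (hE : 1 < ∫ x, EAl (phiAl x.val) ∂μ.toMeasure)
    (hE' : 1 < ∫ x, EAl (phiAl x.val) ∂μ'.toMeasure) :
    ∃ T : Tm M N, ∀ f : BoundedContinuousFunction ↥(SigmaD M N) ℝ,
      ∫ y, f y ∂μ.toMeasure = T.orb f false ∧ ∫ y, f y ∂μ'.toMeasure = T.orb f true := by
  obtain ⟨he, x, n, hn, hx, ho⟩ := hCO
  obtain ⟨he', x', n', hn', hx', ho'⟩ := hCO'
  have hx1 : (shiftD M N)^[n * n'] x = x := by
    rw [Function.iterate_mul]; exact Function.iterate_fixed hx n'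
  have hx2 : (shiftD M N)^[n * n'] x' = x' := by
    rw [mul_comm, Function.iterate_mul]; exact Function.iterate_fixed hx' n
  obtain ⟨y, a1, a2, a3, a4⟩ := co_rot he.toMeasurePreserving (Nat.mul_pos hn hn') hx1 ho hE
  obtain ⟨y', b1, b2, b3, b4⟩ := co_rot he'.toMeasurePreserving (Nat.mul_pos hn hn') hx2 ho' hE'
  refine ⟨{ k0 := ⟨0, by omega⟩
            xh := fun m => if m then y'.val else y.val
            n := n * n'
            hn := Nat.mul_pos hn hn'
            mem := fun m => by cases m <;> simp
            per := fun m i => by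
              cases m
              · exact a1 i
              · exact b1 i
            hH := fun m k => by
              cases m
              · exact a2 k
              · exact b2 k
            hpos := fun m => by
              cases m
              · exact a3
              · exact b3 }, fun f => ⟨?_, ?_⟩⟩
  · rw [a4 f]; rfl
  · rw [b4 f]; rfl

end HCP

namespace HCP
variable {M N : ℕ}

lemma exists_rho (hM : 2 ≤ M) (T : Tm M N) : ∃ ρ : Measure T.O, IsProbabilityMeasure ρ ∧
    ∀ o, ρ {o} ≠ 0 := by
  classical
  have hne : Nonempty T.O := by
    have : Nontrivial (Fin M) := Fin.nontrivial_iff_two_le.2 hM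
    obtain ⟨k, hk⟩ := exists_ne T.k0
    exact ⟨⟨.la k, by simpa using hk, by simp⟩⟩
  refine ⟨(PMF.uniformOfFintype T.O).toMeasure, inferInstance, fun o => ?_⟩
  rw [PMF.toMeasure_apply_singleton _ _ (measurableSet_singleton o)]
  simp

/-- Convex combinations of two probability measures. -/
noncomputable def mix (μ μ' : ProbabilityMeasure ↥(SigmaD M N)) (τ : ℝ) (h0 : 0 ≤ τ) (h1 : τ ≤ 1) :
    ProbabilityMeasure ↥(SigmaD M N) :=
  ⟨ENNReal.ofReal (1 - τ) • μ.toMeasure + (1 - ENNReal.ofReal (1 - τ)) • μ'.toMeasure, ⟨by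
    have h : ENNReal.ofReal (1 - τ) ≤ 1 := by simpa using h0
    simp [add_tsub_cancel_of_le h]⟩⟩

lemma mix_int (μ μ' : ProbabilityMeasure ↥(SigmaD M N)) (τ : ℝ) (h0 : 0 ≤ τ) (h1 : τ ≤ 1)
    (f : BoundedContinuousFunction ↥(SigmaD M N) ℝ) :
    ∫ x, f x ∂(mix μ μ' τ h0 h1).toMeasure = (∫ x, f x ∂μ.toMeasure) +
      τ * ((∫ x, f x ∂μ'.toMeasure) - ∫ x, f x ∂μ.toMeasure) := by
  change ∫ x, f x ∂(ENNReal.ofReal (1 - τ) • μ.toMeasure +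
    (1 - ENNReal.ofReal (1 - τ)) • μ'.toMeasure) = _
  have e2 : 1 - ENNReal.ofReal (1 - τ) = ENNReal.ofReal τ := by
    rw [← ENNReal.ofReal_one, ← ENNReal.ofReal_sub _ (by linarith)]; congr 1; ring
  have hi : ∀ μ : ProbabilityMeasure ↥(SigmaD M N), Integrable f μ.toMeasure := fun μ =>
    f.integrable μ.toMeasure
  rw [e2, integral_add_measure ((hi μ).smul_measure ENNReal.ofReal_ne_top)
    ((hi μ').smul_measure ENNReal.ofReal_ne_top), integral_smul_measure, integral_smul_measure,
    ENNReal.toReal_ofReal (by linarith), ENNReal.toReal_ofReal h0]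
  simp only [smul_eq_mul]; ring

lemma compl_mem {X : Type*} [TopologicalSpace X] [T1Space X] (S : Set X) (hS : S.Finite) (t : X) :
    Sᶜ ∈ 𝓝[≠] t := by
  have h : (S \ {t})ᶜ ∈ 𝓝 t := (hS.sdiff).isClosed.isOpen_compl.mem_nhds (by simp)
  filter_upwards [mem_nhdsWithin_of_mem_nhds h, self_mem_nhdsWithin] with x hx hx' hxS
  exact hx ⟨hxS, hx'⟩

lemma exists_eps (T : Tm M N) (ρ : Measure T.O) [IsProbabilityMeasure ρ] (hρ : ∀ o, ρ {o} ≠ 0)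
    (μ μ' : ProbabilityMeasure ↥(SigmaD M N))
    (hT : ∀ f : BoundedContinuousFunction ↥(SigmaD M N) ℝ,
      ∫ y, f y ∂μ.toMeasure = T.orb f false ∧ ∫ y, f y ∂μ'.toMeasure = T.orb f true)
    (U V : Set (ProbabilityMeasure ↥(SigmaD M N))) (hV : IsOpen V) (hUV : U ⊆ V)
    (hU3 : ConvexMeasSet U) (hμ : μ ∈ U) (hμ' : μ' ∈ U) :
    ∃ ε : ℝ, 0 < ε ∧ ∀ a c : ℝ, 0 < a → 0 < c → a + c < ε → a + c < 1 ∧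
      T.Adm (Tm.law ρ a c).toMeasure ∧ T.nu (Tm.law ρ a c).toMeasure ∈ V := by
  have hK : (1:ℝ) ≤ T.K := by exact_mod_cast T.K_pos
  set ε0 : ℝ := 1 / T.K with hε0
  have hε0p : 0 < ε0 := by positivity
  have hbase : ∀ a c : ℝ, 0 < a → 0 < c → a + c < ε0 → a + c < 1 ∧
      T.Adm (Tm.law ρ a c).toMeasure := by
    intro a c ha hc h
    rw [hε0, lt_div_iff₀ (by linarith)] at h
    have h1 : a + c < 1 := by nlinarith
    exact ⟨h1, Tm.law_adm ρ hρ ha hc h1 (by linarith)⟩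
  by_contra hcon
  push Not at hcon
  have hk : ∀ k : ℕ, ∃ a c : ℝ, 0 < a ∧ 0 < c ∧ a + c < ε0 * (1 / ((k:ℝ) + 1)) ∧
      T.nu (Tm.law ρ a c).toMeasure ∉ V := by
    intro k
    obtain ⟨a, c, ha, hc, h, h'⟩ := hcon (ε0 * (1 / ((k:ℝ) + 1))) (by positivity)
    refine ⟨a, c, ha, hc, h, ?_⟩
    have hle : ε0 * (1 / ((k:ℝ) + 1)) ≤ ε0 := by
      have : 1 / ((k:ℝ) + 1) ≤ 1 := by
        rw [div_le_one (by positivity)]; linarith [Nat.cast_nonneg (α := ℝ) k]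
      nlinarith
    obtain ⟨h1, h2⟩ := hbase a c ha hc (by linarith)
    exact h' h1 h2
  choose a c ha hc hac hnV using hk
  have hle : ∀ k : ℕ, ε0 * (1 / ((k:ℝ) + 1)) ≤ ε0 := by
    intro k
    have : 1 / ((k:ℝ) + 1) ≤ 1 := by
      rw [div_le_one (by positivity)]; linarith [Nat.cast_nonneg (α := ℝ) k]
    nlinarith
  have hb := fun k => hbase (a k) (c k) (ha k) (hc k) ((hac k).trans_le (hle k))
  have hr : ∀ k, a k / (a k + c k) ∈ Set.Icc (0:ℝ) 1 := fun k => by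
    have := ha k; have := hc k
    exact ⟨by positivity, by rw [div_le_one (by positivity)]; linarith⟩
  obtain ⟨τ, hτ, φ, hφ, hlim⟩ := isCompact_Icc.tendsto_subseq hr
  have hη : Tendsto (fun k => a k + c k) atTop (𝓝 0) := by
    have h1 : Tendsto (fun k : ℕ => ε0 * (1 / ((k:ℝ) + 1))) atTop (𝓝 (ε0 * 0)) :=
      tendsto_one_div_add_atTop_nhds_zero_nat.const_mul ε0
    rw [mul_zero] at h1
    exact squeeze_zero (fun k => by have := ha k; have := hc k; positivity) (fun k => (hac k).le) h1
  have hconv := Tm.conv (T := T) (fun k => Tm.law ρ (a (φ k)) (c (φ k))) (fun k => (hb (φ k)).2) τ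
    (by
      refine (hη.comp hφ.tendsto_atTop).congr fun k => ?_
      rw [Tm.law_z ρ (ha _) (hc _) (hb _).1]; rfl)
    (by
      refine hlim.congr fun k => ?_
      rw [Tm.law_z ρ (ha _) (hc _) (hb _).1, Tm.law_b ρ (ha _) (hc _) (hb _).1]; rfl)
    (mix μ μ' τ hτ.1 hτ.2) (fun f => by rw [mix_int, (hT f).1, (hT f).2])
  have hmem : mix μ μ' τ hτ.1 hτ.2 ∈ V :=
    hUV (hU3 μ hμ μ' hμ' (ENNReal.ofReal (1 - τ)) (by simpa using hτ.1) _ rfl)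
  obtain ⟨k, hk⟩ := (hconv.eventually_mem (hV.mem_nhds hmem)).exists
  exact hnV _ hk

open Classical in
/-- The path. -/
noncomputable def pth (T : Tm M N) (ρ : Measure T.O) [IsProbabilityMeasure ρ]
    (μ μ' : ProbabilityMeasure ↥(SigmaD M N)) (ε : ℝ) (t : unitInterval) :
    ProbabilityMeasure ↥(SigmaD M N) :=
  if t = 0 then μ else if t = 1 then μ' else
    T.nu (Tm.law ρ (ε / 2 * ((t:ℝ) * (1 - t)) * t) (ε / 2 * ((t:ℝ) * (1 - t)) * (1 - t))).toMeasure

theorem main (hM : 2 ≤ M)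
    (U : Set (ProbabilityMeasure ↥(SigmaD M N)))
    (hU2 : ∃ V, IsOpen V ∧ U = V ∩ MinvD M N)
    (hU3 : ConvexMeasSet U)
    (μ μ' : ProbabilityMeasure ↥(SigmaD M N))
    (hμ : μ ∈ U ∩ MeAl M N) (hμ' : μ' ∈ U ∩ MeAl M N)
    (hCO : IsCOMeas (shiftD M N) μ) (hCO' : IsCOMeas (shiftD M N) μ')
    (hE : 1 < ∫ x, EAl (phiAl x.val) ∂μ.toMeasure)
    (hE' : 1 < ∫ x, EAl (phiAl x.val) ∂μ'.toMeasure) :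
    ∃ p : unitInterval → ProbabilityMeasure ↥(SigmaD M N),
      HCPath M N p ∧ p 0 = μ ∧ p 1 = μ' ∧ ∀ s, p s ∈ U ∩ MeAl M N := by
  obtain ⟨T, hT⟩ := exists_Tm hM μ μ' hCO hCO' hE hE'
  obtain ⟨ρ, hρ1, hρ⟩ := exists_rho hM T
  obtain ⟨V, hV, hUV⟩ := hU2
  obtain ⟨ε, hε, hall⟩ := exists_eps T ρ hρ μ μ' hT U V hV (hUV ▸ Set.inter_subset_left) hU3 hμ.1 hμ'.1
  set p := pth T ρ μ μ' ε with hpdef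
  set A : unitInterval → ℝ := fun t => ε / 2 * ((t:ℝ) * (1 - t)) * t with hA
  set C : unitInterval → ℝ := fun t => ε / 2 * ((t:ℝ) * (1 - t)) * (1 - t) with hC
  have p0 : p 0 = μ := by simp [hpdef, pth]
  have p1 : p 1 = μ' := by simp [hpdef, pth]
  have pin : ∀ t : unitInterval, t ∉ ({0, 1} : Set unitInterval) →
      p t = T.nu (Tm.law ρ (A t) (C t)).toMeasure := by
    intro t ht
    simp only [Set.mem_insert_iff, Set.mem_singleton_iff, not_or] at ht
    simp only [hpdef, pth]
    rw [if_neg ht.1, if_neg ht.2]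
  have hinn : ∀ t : unitInterval, t ∉ ({0, 1} : Set unitInterval) → 0 < (t:ℝ) ∧ (t:ℝ) < 1 := by
    intro t ht
    simp only [Set.mem_insert_iff, Set.mem_singleton_iff, not_or] at ht
    exact ⟨unitInterval.pos_iff_ne_zero.2 ht.1, unitInterval.lt_one_iff_ne_one.2 ht.2⟩
  have hsum : ∀ t, A t + C t = ε / 2 * ((t:ℝ) * (1 - t)) := fun t => by simp only [hA, hC]; ring
  have hpos : ∀ t : unitInterval, t ∉ ({0, 1} : Set unitInterval) → 0 < A t ∧ 0 < C t := by
    intro t ht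
    obtain ⟨h0, h1⟩ := hinn t ht
    have h1' : 0 < 1 - (t:ℝ) := by linarith
    exact ⟨by simp only [hA]; positivity, by simp only [hC]; positivity⟩
  have hsm : ∀ t, A t + C t < ε := by
    intro t
    rw [hsum]
    have h0 := t.2.1; have h1 := t.2.2
    have : (t:ℝ) * (1 - t) ≤ 1 := by nlinarith
    nlinarith
  have hadm : ∀ t : unitInterval, t ∉ ({0, 1} : Set unitInterval) → A t + C t < 1 ∧
      T.Adm (Tm.law ρ (A t) (C t)).toMeasure ∧ T.nu (Tm.law ρ (A t) (C t)).toMeasure ∈ V :=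
    fun t ht => hall _ _ (hpos t ht).1 (hpos t ht).2 (hsm t)
  have hratio : ∀ t : unitInterval, t ∉ ({0, 1} : Set unitInterval) → A t / (A t + C t) = t := by
    intro t ht
    obtain ⟨h0, h1⟩ := hinn t ht
    have h1' : 0 < 1 - (t:ℝ) := by linarith
    rw [hsum]; simp only [hA]; field_simp
  have hAc : Continuous A := by simp only [hA]; fun_prop
  have hCc : Continuous C := by simp only [hC]; fun_prop
  have hmem : ∀ s, p s ∈ U ∩ MeAl M N := by
    intro s
    by_cases hs : s ∈ ({0, 1} : Set unitInterval)
    · rcases hs with rfl | hs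
      · rw [p0]; exact hμ
      · rw [Set.mem_singleton_iff.1 hs, p1]; exact hμ'
    · obtain ⟨h1, h2, h3⟩ := hadm s hs
      rw [pin s hs]
      refine ⟨?_, Tm.nu_MeAl h2⟩
      rw [hUV]; exact ⟨h3, Tm.nu_mp h2⟩
  have hcont : Continuous p := by
    rw [continuous_iff_continuousAt]
    intro t
    rw [← continuousWithinAt_compl_self]
    refine tendsto_of_seq_tendsto fun s hs => ?_
    have hev := hs.eventually_mem (compl_mem ({0, 1} : Set unitInterval) (by simp) t)
    obtain ⟨k0, hk0⟩ := eventually_atTop.1 hev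
    rw [← tendsto_add_atTop_iff_nat k0] at hs ⊢
    have hin : ∀ k, s (k + k0) ∉ ({0, 1} : Set unitInterval) := fun k => hk0 _ (by omega)
    have hst : Tendsto (fun k => s (k + k0)) atTop (𝓝 t) := hs.mono_right nhdsWithin_le_nhds
    have hcongr : ∀ k, T.nu (Tm.law ρ (A (s (k + k0))) (C (s (k + k0)))).toMeasure =
        p (s (k + k0)) := fun k => (pin _ (hin k)).symm
    by_cases ht : t ∈ ({0, 1} : Set unitInterval)
    · refine (Tm.conv (T := T) (fun k => Tm.law ρ (A (s (k + k0))) (C (s (k + k0))))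
        (fun k => (hadm _ (hin k)).2.1) t ?_ ?_ (p t) ?_).congr hcongr
      · have h1 : Tendsto (fun k => A (s (k + k0)) + C (s (k + k0))) atTop (𝓝 (A t + C t)) :=
          ((hAc.add hCc).tendsto t).comp hst
        have h2 : A t + C t = 0 := by
          rw [hsum]
          rcases ht with rfl | ht
          · simp
          · rw [Set.mem_singleton_iff.1 ht]; simp
        rw [h2] at h1
        refine h1.congr fun k => ?_
        rw [Tm.law_z ρ (hpos _ (hin k)).1 (hpos _ (hin k)).2 (hadm _ (hin k)).1]
      · have h1 : Tendsto (fun k => ((s (k + k0) : unitInterval) : ℝ)) atTop (𝓝 (t:ℝ)) :=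
          (continuous_subtype_val.tendsto t).comp hst
        refine h1.congr fun k => ?_
        rw [Tm.law_z ρ (hpos _ (hin k)).1 (hpos _ (hin k)).2 (hadm _ (hin k)).1,
          Tm.law_b ρ (hpos _ (hin k)).1 (hpos _ (hin k)).2 (hadm _ (hin k)).1, hratio _ (hin k)]
      · intro f
        rcases ht with rfl | ht
        · rw [p0, (hT f).1]; simp
        · rw [Set.mem_singleton_iff.1 ht, p1, (hT f).2]; simp
    · rw [pin t ht]
      exact (Tm.law_cont ρ _ _ ((hAc.tendsto t).comp hst) ((hCc.tendsto t).comp hst)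
        (fun k => (hadm _ (hin k)).2.1) (hadm t ht).2.1).congr hcongr
  refine ⟨p, ⟨hcont, fun t => (hmem t).2.1, ?_, fun t => ?_⟩, p0, p1, hmem⟩
  · refine Set.Countable.mono ?_ (Set.to_countable ({0, 1} : Set unitInterval))
    intro t ht
    by_contra hc
    apply ht
    rw [pin t hc]
    exact ⟨Tm.nu_full (hadm t hc).2.1, Tm.nu_bern (hadm t hc).2.1⟩
  · have hsub : ({s : unitInterval | p s = p t} ∩ ({0, 1} : Set unitInterval)ᶜ).Subsingleton := by
      rintro s ⟨h1, hs⟩ s' ⟨h2, hs'⟩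
      have h1 : p s = p t := h1
      have h2 : p s' = p t := h2
      rw [← h2, pin s hs, pin s' hs'] at h1
      have h3 := Tm.nu_inj (hadm s hs).2.1 (hadm s' hs').2.1 h1
      have e1 := Tm.law_b ρ (hpos s hs).1 (hpos s hs).2 (hadm s hs).1
      have e2 := Tm.law_z ρ (hpos s hs).1 (hpos s hs).2 (hadm s hs).1
      rw [h3, Tm.law_b ρ (hpos s' hs').1 (hpos s' hs').2 (hadm s' hs').1] at e1
      rw [h3, Tm.law_z ρ (hpos s' hs').1 (hpos s' hs').2 (hadm s' hs').1] at e2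
      apply Subtype.ext
      rw [← hratio s hs, ← hratio s' hs', e2, e1]
    refine (hsub.countable.union (Set.to_countable ({0, 1} : Set unitInterval))).mono ?_
    intro s hs
    by_cases h : s ∈ ({0, 1} : Set unitInterval)
    · exact Or.inr h
    · exact Or.inl ⟨hs, h⟩

end HCP

/-- Lemma 3.6: for any convex open subset `U` of `M(Σ_D)` and any pair of distinct
`CO`-measures `μ, μ' ∈ U ∩ M^e_α(Σ_D)` with `∫ E_α∘φ_α dμ > 1` and `∫ E_α∘φ_α dμ' > 1`,
there is a high complexity path lying in `U ∩ M^e_α(Σ_D)` joining them. -/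
theorem high_complexity_path_CO (M N : ℕ) (hM : 2 ≤ M)
    (U : Set (ProbabilityMeasure ↥(SigmaD M N)))
    (hU1 : U ⊆ MinvD M N) (hU2 : ∃ V, IsOpen V ∧ U = V ∩ MinvD M N)
    (hU3 : ConvexMeasSet U)
    (μ μ' : ProbabilityMeasure ↥(SigmaD M N))
    (hμ : μ ∈ U ∩ MeAl M N) (hμ' : μ' ∈ U ∩ MeAl M N)
    (hCO : IsCOMeas (shiftD M N) μ) (hCO' : IsCOMeas (shiftD M N) μ')
    (hne : μ ≠ μ')
    (hE : 1 < ∫ x, EAl (phiAl x.val) ∂μ.toMeasure)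
    (hE' : 1 < ∫ x, EAl (phiAl x.val) ∂μ'.toMeasure) :
    ∃ p : unitInterval → ProbabilityMeasure ↥(SigmaD M N),
      HCPath M N p ∧ p 0 = μ ∧ p 1 = μ' ∧ ∀ s, p s ∈ U ∩ MeAl M N := by
  exact HCP.main hM U hU2 hU3 μ μ' hμ hμ' hCO hCO' hE hE'
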